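/- arXiv:math/9407215 — 2 statements merged into one kernel-verified Lean document; each statement's English description precedes it below -/
import Mathlib

section
/- Let p ≥ 3 be an integer and let E_{1/p} ⊆ Γ be the perfect symmetric set of constant ratio 1/p. Then J₀⁺(E_{1/p}) is weak-star dense in A⁺. -/
noncomputable section

/-- An invertible contraction on a (complex) Banach space. -/
structure BanachContraction where
  X : Type
  [grp : NormedAddCommGroup X]
  [mod : NormedSpace ℂ X]
  [cpl : CompleteSpace X]
  T : X →L[ℂ] X
  Tinv : X →L[ℂ] X
  norm_le : ‖T‖ ≤ 1
  mul_inv : T * Tinv = 1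
  inv_mul : Tinv * T = 1

attribute [instance] BanachContraction.grp BanachContraction.mod BanachContraction.cpl

open Complex MeasureTheory Metric Set Filter

/-- The `n`-th Taylor coefficient of `f` at `0`, i.e. `f⁽ⁿ⁾(0)/n!`. -/
def taylorCoeff (f : ℂ → ℂ) (n : ℕ) : ℂ := iteratedDeriv n f 0 / (n.factorial : ℂ)

/-- `A⁺`, the algebra of absolutely convergent Taylor series: functions which, on the
closed unit disk, are sums of a power series with absolutely summable coefficients. -/
def APlus : Set (ℂ → ℂ) :=
  {f | ∃ a : ℕ → ℂ, Summable (fun n => ‖a n‖) ∧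
    ∀ z ∈ Metric.closedBall (0 : ℂ) 1, HasSum (fun n => a n * z ^ n) (f z)}

/-- The norm `‖f‖₁ = ∑ₙ |f⁽ⁿ⁾(0)/n!|` on `A⁺`. -/
def APlusNorm (f : ℂ → ℂ) : ℝ := ∑' n : ℕ, ‖taylorCoeff f n‖

/-- The `n`-th Fourier coefficient of (the boundary values of) `f` on the unit circle. -/
def fcoeff (f : ℂ → ℂ) (n : ℤ) : ℂ :=
  (1 / (2 * Real.pi)) * ∫ θ in (0:ℝ)..(2 * Real.pi),
    f (Complex.exp ((θ : ℂ) * Complex.I)) * Complex.exp (-(n : ℂ) * (θ : ℂ) * Complex.I)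

/-- The Wiener algebra `A(Γ)` of absolutely convergent Fourier series on the unit circle,
viewed as functions `ℂ → ℂ` (only the values on the unit circle are relevant). -/
def WienerAlg : Set (ℂ → ℂ) :=
  {f | Summable (fun n : ℤ => ‖fcoeff f n‖) ∧
    ∀ z ∈ Metric.sphere (0 : ℂ) 1, HasSum (fun n : ℤ => fcoeff f n * z ^ n) (f z)}

/-- The norm `‖f‖₁ = ∑_{n ∈ ℤ} |f̂(n)|` on `A(Γ)`. -/
def WienerNorm (f : ℂ → ℂ) : ℝ := ∑' n : ℤ, ‖fcoeff f n‖

/-- `I` is a closed ideal of `A⁺` (closedness w.r.t. the norm `APlusNorm`). -/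
def IsClosedIdealAPlus (I : Set (ℂ → ℂ)) : Prop :=
  I ⊆ APlus ∧
  (∀ f ∈ I, ∀ g ∈ I, f + g ∈ I) ∧
  (∀ f ∈ APlus, ∀ g ∈ I, f * g ∈ I) ∧
  (∀ f ∈ APlus, (∀ ε > 0, ∃ g ∈ I, APlusNorm (f - g) < ε) → f ∈ I)

/-- `J` is a closed ideal of the Wiener algebra `A(Γ)`. -/
def IsClosedIdealW (J : Set (ℂ → ℂ)) : Prop :=
  J ⊆ WienerAlg ∧
  (∀ f ∈ J, ∀ g ∈ J, f + g ∈ J) ∧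
  (∀ f ∈ WienerAlg, ∀ g ∈ J, f * g ∈ J) ∧
  (∀ f ∈ WienerAlg, (∀ ε > 0, ∃ g ∈ J, WienerNorm (f - g) < ε) → f ∈ J)

/-- `I^A` : the closed ideal generated by `I` in the Wiener algebra `A(Γ)`. -/
def IdealGenW (I : Set (ℂ → ℂ)) : Set (ℂ → ℂ) := ⋂₀ {J | IsClosedIdealW J ∧ I ⊆ J}

/-- The hull `h(I)`: common zeros in the closed unit disk of all elements of `I`. -/
def hull (I : Set (ℂ → ℂ)) : Set ℂ :=
  {z ∈ Metric.closedBall (0 : ℂ) 1 | ∀ f ∈ I, f z = 0}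

/-- `I ≠ {0}`: `I` contains an element not identically zero on the unit disk. -/
def NontrivialIdeal (I : Set (ℂ → ℂ)) : Prop :=
  ∃ f ∈ I, ∃ z ∈ Metric.ball (0 : ℂ) 1, f z ≠ 0

/-- `H^∞(D)`: bounded holomorphic functions on the open unit disk. -/
def Hinf : Set (ℂ → ℂ) :=
  {f | DifferentiableOn ℂ f (Metric.ball (0 : ℂ) 1) ∧
    ∃ C : ℝ, ∀ z ∈ Metric.ball (0 : ℂ) 1, ‖f z‖ ≤ C}

/-- An inner function: a bounded-by-one holomorphic function on the unit disk whose
radial limits have modulus `1` at almost every boundary point. -/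
def IsInnerFunction (u : ℂ → ℂ) : Prop :=
  DifferentiableOn ℂ u (Metric.ball (0 : ℂ) 1) ∧
  (∀ z ∈ Metric.ball (0 : ℂ) 1, ‖u z‖ ≤ 1) ∧
  ∀ᵐ (θ : ℝ) ∂(MeasureTheory.volume.restrict (Set.Ioc (0 : ℝ) (2 * Real.pi))),
    Filter.Tendsto (fun r : ℝ => ‖u ((r : ℂ) * Complex.exp ((θ : ℂ) * Complex.I))‖)
      (nhdsWithin 1 (Set.Iio 1)) (nhds 1)

/-- `S` divides (the inner factor of) `f`, i.e. `f ∈ S·H^∞`. -/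
def InnerDivides (S f : ℂ → ℂ) : Prop :=
  ∃ g ∈ Hinf, ∀ z ∈ Metric.ball (0 : ℂ) 1, f z = S z * g z

/-- `S` is a greatest common divisor of the inner factors of the nonzero elements of `I`:
`S` is inner, divides every nonzero element of `I`, and every inner function with this
property divides `S`. -/
def IsGcdInner (I : Set (ℂ → ℂ)) (S : ℂ → ℂ) : Prop :=
  IsInnerFunction S ∧
  (∀ f ∈ I, (∃ z ∈ Metric.ball (0 : ℂ) 1, f z ≠ 0) → InnerDivides S f) ∧
  ∀ S' : ℂ → ℂ, IsInnerFunction S' →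
    (∀ f ∈ I, (∃ z ∈ Metric.ball (0 : ℂ) 1, f z ≠ 0) → InnerDivides S' f) →
    InnerDivides S' S

/-- The perfect symmetric set `E_ξ` of constant ratio `ξ` on the unit circle. -/
def Eset (ξ : ℝ) : Set ℂ :=
  {z | ∃ ε : ℕ → ℕ, (∀ k, ε k ≤ 1) ∧
    z = Complex.exp (2 * Real.pi * Complex.I *
      (((1 - ξ) * ∑' k : ℕ, (ε k : ℝ) * ξ ^ k : ℝ) : ℂ))}

/-- A Carleson set: a closed subset of the unit circle with
`∫_{-π}^{π} log (2 / dist(e^{iθ}, E)) dθ < ∞`. -/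
def IsCarleson (E : Set ℂ) : Prop :=
  IsClosed E ∧ E ⊆ Metric.sphere (0 : ℂ) 1 ∧
  MeasureTheory.IntegrableOn
    (fun θ : ℝ => Real.log (2 / Metric.infDist (Complex.exp ((θ : ℂ) * Complex.I)) E))
    (Set.Ioc (-Real.pi) Real.pi)

/-- The division ideal `I(f) = {g ∈ A⁺ : fg ∈ I}`. -/
def Idiv (I : Set (ℂ → ℂ)) (f : ℂ → ℂ) : Set (ℂ → ℂ) := {g ∈ APlus | f * g ∈ I}

/-- `f` belongs to `A^∞(D)` and vanishes on `E` together with all its derivatives: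
`f` is holomorphic on the disk, and each derivative extends continuously to the closed
disk with the extension vanishing on `E`. -/
def VanishAllDeriv (E : Set ℂ) (f : ℂ → ℂ) : Prop :=
  ContinuousOn f (Metric.closedBall (0 : ℂ) 1) ∧
  DifferentiableOn ℂ f (Metric.ball (0 : ℂ) 1) ∧
  (∀ z ∈ E, f z = 0) ∧
  ∀ n : ℕ, ∃ g : ℂ → ℂ, ContinuousOn g (Metric.closedBall (0 : ℂ) 1) ∧
    Set.EqOn g (iteratedDeriv n f) (Metric.ball (0 : ℂ) 1) ∧ ∀ z ∈ E, g z = 0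

/-- `J₀⁺(E)`: the closure in `A⁺` of the set of elements of `A^∞(D)` vanishing on `E`
together with all their derivatives. -/
def J0Plus (E : Set ℂ) : Set (ℂ → ℂ) :=
  {f | f ∈ APlus ∧ ∀ ε > 0, ∃ g ∈ APlus, VanishAllDeriv E g ∧ APlusNorm (f - g) < ε}

/-- `I⁺(E) = {f ∈ A⁺ : f ≡ 0 on E}`. -/
def IPlus (E : Set ℂ) : Set (ℂ → ℂ) := {f ∈ APlus | ∀ z ∈ E, f z = 0}

/-- The pairing of `f ∈ A⁺ ≅ ℓ¹(ℕ)` with an element `c ∈ c₀`. -/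
def pairing (f : ℂ → ℂ) (c : ℕ → ℂ) : ℂ := ∑' n : ℕ, taylorCoeff f n * c n

/-- `S` is dense in `A⁺` for the weak-star topology `σ(ℓ¹, c₀)`. -/
def WStarDense (S : Set (ℂ → ℂ)) : Prop :=
  ∀ f ∈ APlus, ∀ (m : ℕ) (c : Fin m → ℕ → ℂ),
    (∀ i, Filter.Tendsto (c i) Filter.atTop (nhds 0)) →
    ∀ ε > 0, ∃ g ∈ S, ∀ i, ‖pairing f (c i) - pairing g (c i)‖ < ε

/-- `S` is closed in `A⁺` for the weak-star topology `σ(ℓ¹, c₀)`. -/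
def WStarClosed (S : Set (ℂ → ℂ)) : Prop :=
  S ⊆ APlus ∧
  ∀ f ∈ APlus,
    (∀ (m : ℕ) (c : Fin m → ℕ → ℂ),
      (∀ i, Filter.Tendsto (c i) Filter.atTop (nhds 0)) →
      ∀ ε > 0, ∃ g ∈ S, ∀ i, ‖pairing f (c i) - pairing g (c i)‖ < ε) → f ∈ S

/-- A Kronecker set: a compact subset of the unit circle on which every continuous
unimodular function is a uniform limit of characters `z ↦ zⁿ`, `n ∈ ℤ`. -/
def IsKronecker (K : Set ℂ) : Prop :=
  IsCompact K ∧ K ⊆ Metric.sphere (0 : ℂ) 1 ∧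
  ∀ f : ℂ → ℂ, ContinuousOn f K → (∀ z ∈ K, ‖f z‖ = 1) →
    ∀ ε > 0, ∃ n : ℤ, ∀ z ∈ K, ‖f z - z ^ n‖ < ε

/-- A Helson set: a compact subset of the unit circle on which every continuous function
is the restriction of an element of the Wiener algebra. -/
def IsHelson (K : Set ℂ) : Prop :=
  IsCompact K ∧ K ⊆ Metric.sphere (0 : ℂ) 1 ∧
  ∀ f : ℂ → ℂ, ContinuousOn f K → ∃ g ∈ WienerAlg, ∀ z ∈ K, f z = g z

/-- The little Lipschitz class `Λ_α(D)`: disc-algebra functions with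
`|f(e^{it₁}) - f(e^{it₂})| / |t₁-t₂|^α → 0` uniformly as `|t₁-t₂| → 0`. -/
def LittleLip (α : ℝ) (f : ℂ → ℂ) : Prop :=
  ContinuousOn f (Metric.closedBall (0 : ℂ) 1) ∧
  DifferentiableOn ℂ f (Metric.ball (0 : ℂ) 1) ∧
  ∀ ε > 0, ∃ δ > 0, ∀ t₁ t₂ : ℝ, t₁ ≠ t₂ → |t₁ - t₂| < δ →
    ‖f (Complex.exp ((t₁ : ℂ) * Complex.I)) - f (Complex.exp ((t₂ : ℂ) * Complex.I))‖ ≤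
      ε * |t₁ - t₂| ^ α

/-- The perfect part of a set: the union of all its perfect subsets. -/
def perfectPart (C : Set ℂ) : Set ℂ := ⋃₀ {P | Perfect P ∧ P ⊆ C}

/-- A distribution on the unit circle, encoded by its sequence of Fourier coefficients
`μ̂(n) = μ(e^{-int})`, which has polynomial growth. -/
structure CircleDistribution where
  coeff : ℤ → ℂ
  growth : ∃ (C : ℝ) (k : ℕ), ∀ n : ℤ, ‖coeff n‖ ≤ C * (1 + (n.natAbs : ℝ)) ^ k

/-- A smooth `2π`-periodic function (test function on the circle). -/
def PeriodicSmooth (φ : ℝ → ℂ) : Prop :=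
  ContDiff ℝ (⊤ : ℕ∞) φ ∧ ∀ θ : ℝ, φ (θ + 2 * Real.pi) = φ θ

/-- Fourier coefficients of a test function. -/
def testCoeff (φ : ℝ → ℂ) (n : ℤ) : ℂ :=
  (1 / (2 * Real.pi)) * ∫ θ in (0:ℝ)..(2 * Real.pi),
    φ θ * Complex.exp (-(n : ℂ) * (θ : ℂ) * Complex.I)

/-- The action of a distribution on a test function: `μ(φ) = ∑ₙ μ̂(n) φ̂(-n)`. -/
def distAct (μ : CircleDistribution) (φ : ℝ → ℂ) : ℂ := ∑' n : ℤ, μ.coeff n * testCoeff φ (-n)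

/-- The support of a distribution on the circle: the points of the circle having no open
neighbourhood `U` such that `μ` kills every test function supported in `U`. -/
def distSupport (μ : CircleDistribution) : Set ℂ :=
  {z ∈ Metric.sphere (0 : ℂ) 1 | ∀ U : Set ℂ, IsOpen U → z ∈ U →
    ∃ φ : ℝ → ℂ, PeriodicSmooth φ ∧
      (∀ θ : ℝ, Complex.exp ((θ : ℂ) * Complex.I) ∉ U → φ θ = 0) ∧ distAct μ φ ≠ 0}

/-- A set of multiplicity: a closed subset of the circle supporting a nonzero
pseudofunction (distribution whose Fourier coefficients tend to `0` as `|n| → ∞`). -/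
def IsMSet (E : Set ℂ) : Prop :=
  IsClosed E ∧ E ⊆ Metric.sphere (0 : ℂ) 1 ∧
  ∃ μ : CircleDistribution, μ.coeff ≠ 0 ∧ distSupport μ ⊆ E ∧
    Filter.Tendsto μ.coeff Filter.cofinite (nhds 0)

/-- A Dirichlet set: `sup_{z ∈ E} |z^{n_k} - 1| → 0` for some sequence `n_k → ∞`. -/
def IsDirichletSet (E : Set ℂ) : Prop :=
  ∃ n : ℕ → ℕ, Filter.Tendsto n Filter.atTop Filter.atTop ∧
    ∀ ε > 0, ∀ᶠ k in Filter.atTop, ∀ z ∈ E, ‖z ^ (n k) - 1‖ < ε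

lemma taylorCoeff_of_hasSum {f : ℂ → ℂ} {b : ℕ → ℂ} (hb : Summable fun n => ‖b n‖)
    (h : ∀ z ∈ Metric.ball (0 : ℂ) 1, HasSum (fun n => b n * z ^ n) (f z)) (n : ℕ) :
    taylorCoeff f n = b n := by
  have h1 : HasFPowerSeriesOnBall f (FormalMultilinearSeries.ofScalars ℂ b) 0 1 := by
    refine ⟨?_, one_pos, ?_⟩
    · have := (FormalMultilinearSeries.ofScalars ℂ b).le_radius_of_summable_norm (r := 1)
        (by simpa [FormalMultilinearSeries.ofScalars_norm] using hb)
      simpa using this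
    · intro y hy
      have := h y (by
        rw [← ENNReal.ofReal_one, Metric.eball_ofReal] at hy
        exact hy)
      simpa [FormalMultilinearSeries.ofScalars_apply_eq, zero_add, smul_eq_mul, mul_comm] using this
  have h2 := h1.hasFPowerSeriesAt
  have h3 := h2.eq_formalMultilinearSeries h2.analyticAt.hasFPowerSeriesAt
  have := congrArg (fun p => p.coeff n) h3
  simpa [taylorCoeff] using this.symm

lemma summable_norm_of_hasSum_closedBall {f : ℂ → ℂ} {b : ℕ → ℂ}
    (h : ∀ z ∈ Metric.closedBall (0 : ℂ) 1, HasSum (fun n => b n * z ^ n) (f z)) :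
    Summable fun n => ‖b n‖ := by
  have := (h 1 (by simp)).summable
  simpa using this.norm

lemma taylorCoeff_of_hasSum_closedBall {f : ℂ → ℂ} {b : ℕ → ℂ}
    (h : ∀ z ∈ Metric.closedBall (0 : ℂ) 1, HasSum (fun n => b n * z ^ n) (f z)) :
    taylorCoeff f = b :=
  funext fun n => taylorCoeff_of_hasSum (summable_norm_of_hasSum_closedBall h)
    (fun z hz => h z (Metric.ball_subset_closedBall hz)) n

lemma pow_mem_unit_ball {z : ℂ} {N : ℕ} (hN : N ≠ 0) (hz : z ∈ Metric.ball (0 : ℂ) 1) :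
    z ^ N ∈ Metric.ball (0 : ℂ) 1 := by
  simp only [mem_ball_zero_iff, norm_pow] at *
  exact pow_lt_one₀ (norm_nonneg _) hz hN

lemma pow_mem_unit_closedBall {z : ℂ} (N : ℕ) (hz : z ∈ Metric.closedBall (0 : ℂ) 1) :
    z ^ N ∈ Metric.closedBall (0 : ℂ) 1 := by
  simp only [mem_closedBall_zero_iff, norm_pow] at *
  exact pow_le_one₀ (norm_nonneg _) hz

/-- Flatness on `E` is preserved under substitution of `z ^ N` and multiplication by a
polynomial, if `z ↦ z ^ N` maps `E` to itself. -/
lemma flat_polynomial_mul_comp_pow {E : Set ℂ} {N : ℕ} (hN : N ≠ 0) (hE : ∀ z ∈ E, z ^ N ∈ E)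
    (k : ℕ) : ∀ (F : ℂ → ℂ) (Q : Polynomial ℂ), DifferentiableOn ℂ F (Metric.ball 0 1) →
      (∀ n : ℕ, ∃ g : ℂ → ℂ, ContinuousOn g (Metric.closedBall (0 : ℂ) 1) ∧
        Set.EqOn g (iteratedDeriv n F) (Metric.ball (0 : ℂ) 1) ∧ ∀ z ∈ E, g z = 0) →
      ∃ g : ℂ → ℂ, ContinuousOn g (Metric.closedBall (0 : ℂ) 1) ∧
        Set.EqOn g (iteratedDeriv k fun z => Q.eval z * F (z ^ N)) (Metric.ball (0 : ℂ) 1) ∧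
        ∀ z ∈ E, g z = 0 := by
  have hd : ∀ (F : ℂ → ℂ) (Q : Polynomial ℂ), DifferentiableOn ℂ F (Metric.ball 0 1) →
      DifferentiableOn ℂ (fun z => Q.eval z * F (z ^ N)) (Metric.ball 0 1) := fun F Q hF =>
    Q.differentiable.differentiableOn.mul
      (hF.comp (differentiable_pow N).differentiableOn fun z hz => pow_mem_unit_ball hN hz)
  induction k with
  | zero =>
    intro F Q hF h
    obtain ⟨g, hg, hgF, hg0⟩ := h 0
    refine ⟨fun z => Q.eval z * g (z ^ N), ?_, ?_, ?_⟩
    · exact Q.continuous.continuousOn.mul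
        (hg.comp (continuous_pow N).continuousOn fun z hz => pow_mem_unit_closedBall N hz)
    · intro z hz
      have := hgF (pow_mem_unit_ball hN hz)
      simp only [iteratedDeriv_zero] at this ⊢
      rw [this]
    · intro z hz
      simp [hg0 _ (hE z hz)]
  | succ k ih =>
    intro F Q hF h
    have hF' := hF.deriv Metric.isOpen_ball
    obtain ⟨g₁, hc₁, he₁, hz₁⟩ := ih F (Polynomial.derivative Q) hF h
    obtain ⟨g₂, hc₂, he₂, hz₂⟩ := ih (deriv F)
      (Q * (Polynomial.C (N : ℂ) * Polynomial.X ^ (N - 1))) hF' fun n => by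
        obtain ⟨g, hg⟩ := h (n + 1)
        rw [iteratedDeriv_succ'] at hg
        exact ⟨g, hg⟩
    refine ⟨fun z => g₁ z + g₂ z, hc₁.add hc₂, ?_, fun z hz => by simp [hz₁ z hz, hz₂ z hz]⟩
    have key : Set.EqOn (deriv fun z => Q.eval z * F (z ^ N))
        (fun z => (Polynomial.derivative Q).eval z * F (z ^ N) +
          (Q * (Polynomial.C (N : ℂ) * Polynomial.X ^ (N - 1))).eval z * deriv F (z ^ N))
        (Metric.ball 0 1) := by
      intro z hz
      have h1 : HasDerivAt F (deriv F (z ^ N)) (z ^ N) :=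
        (hF.differentiableAt
          (Metric.isOpen_ball.mem_nhds (pow_mem_unit_ball hN hz))).hasDerivAt
      have h2 := (Q.hasDerivAt z).mul (HasDerivAt.comp (h := fun w => w ^ N) z h1 (hasDerivAt_pow N z))
      have h3 := h2.deriv
      simp only [Polynomial.eval_mul, Polynomial.eval_C, Polynomial.eval_pow, Polynomial.eval_X]
      refine Eq.trans h3 ?_
      simp only [Function.comp]
      ring
    intro z hz
    rw [iteratedDeriv_succ', key.iteratedDeriv_of_isOpen Metric.isOpen_ball k hz]
    have hcd : ∀ (F : ℂ → ℂ) (Q : Polynomial ℂ), DifferentiableOn ℂ F (Metric.ball 0 1) →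
        ContDiffAt ℂ k (fun z => Q.eval z * F (z ^ N)) z := fun F Q hF =>
      ((hd F Q hF).analyticOnNhd Metric.isOpen_ball z hz).contDiffAt
    rw [iteratedDeriv_fun_add (hcd _ _ hF) (hcd _ _ hF'), ← he₁ hz, ← he₂ hz]

lemma hasSum_shifted_dilate {g : ℂ → ℂ} {a : ℕ → ℂ} {N : ℕ} (hN : N ≠ 0)
    (h : ∀ z ∈ Metric.closedBall (0 : ℂ) 1, HasSum (fun n => a n * z ^ n) (g z)) (m : ℕ)
    {z : ℂ} (hz : z ∈ Metric.closedBall (0 : ℂ) 1) :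
    HasSum (fun j => Function.extend (fun n => n * N + m) a 0 j * z ^ j) (z ^ m * g (z ^ N)) := by
  have hinj : Function.Injective fun n : ℕ => n * N + m := fun x y hxy =>
    Nat.eq_of_mul_eq_mul_right (Nat.pos_of_ne_zero hN) (Nat.add_right_cancel hxy)
  refine (hinj.hasSum_iff ?_).1 ?_
  · intro j hj
    rw [Function.extend_apply' _ _ _ (by simpa using hj)]
    simp
  · have e : (fun j => Function.extend (fun n => n * N + m) a 0 j * z ^ j) ∘
        (fun n => n * N + m) = fun n => z ^ m * (a n * (z ^ N) ^ n) := by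
      ext n
      rw [Function.comp_apply, hinj.extend_apply, pow_add, mul_comm n N, pow_mul]
      ring
    rw [e]
    exact (h (z ^ N) (pow_mem_unit_closedBall N hz)).mul_left (z ^ m)

lemma exists_norm_le_of_tendsto_zero {c : ℕ → ℂ} (hc : Tendsto c atTop (nhds 0)) :
    ∃ C : ℝ, ∀ n, ‖c n‖ ≤ C := by
  obtain ⟨C, hC⟩ := (Metric.isBounded_range_of_tendsto c hc).exists_norm_le
  exact ⟨C, fun n => hC _ (Set.mem_range_self n)⟩

lemma summable_mul_of_bounded {a c : ℕ → ℂ} (ha : Summable fun n => ‖a n‖) {C : ℝ}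
    (hC : ∀ n, ‖c n‖ ≤ C) : Summable fun n => a n * c n := by
  refine Summable.of_norm_bounded (g := fun n => ‖a n‖ * C) (ha.mul_right C) fun n => ?_
  rw [norm_mul]
  exact mul_le_mul_of_nonneg_left (hC n) (norm_nonneg _)

lemma hasSum_extend_mul {a c : ℕ → ℂ} (ha : Summable fun n => ‖a n‖)
    (hc : Tendsto c atTop (nhds 0)) {N : ℕ} (hN : N ≠ 0) (m : ℕ) :
    HasSum (fun j => Function.extend (fun n => n * N + m) a 0 j * c j)
      (∑' n, a n * c (n * N + m)) := by
  have hinj : Function.Injective fun n : ℕ => n * N + m := fun x y hxy =>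
    Nat.eq_of_mul_eq_mul_right (Nat.pos_of_ne_zero hN) (Nat.add_right_cancel hxy)
  obtain ⟨C, hC⟩ := exists_norm_le_of_tendsto_zero hc
  refine (hinj.hasSum_iff ?_).1 ?_
  · intro j hj
    rw [Function.extend_apply' _ _ _ (by simpa using hj)]
    simp
  · have := (summable_mul_of_bounded (c := fun n => c (n * N + m)) ha fun n => hC _).hasSum
    convert this using 2 with n
    rw [Function.comp_apply, hinj.extend_apply]

lemma tendsto_tsum_dilate {a c : ℕ → ℂ} (ha : Summable fun n => ‖a n‖)
    (hc : Tendsto c atTop (nhds 0)) {N : ℕ → ℕ} (hN : Tendsto N atTop atTop) (m : ℕ) :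
    Tendsto (fun k => ∑' n, a n * c (n * N k + m)) atTop (nhds (a 0 * c m)) := by
  obtain ⟨C, hC⟩ := exists_norm_le_of_tendsto_zero hc
  have h0 : ∑' n, (if n = 0 then a 0 * c m else 0) = a 0 * c m := tsum_ite_eq 0 _
  rw [← h0]
  refine tendsto_tsum_of_dominated_convergence (bound := fun n => ‖a n‖ * C) (ha.mul_right C) ?_ ?_
  · intro n
    rcases Nat.eq_zero_or_pos n with rfl | hn
    · simp
    · rw [if_neg hn.ne', ← mul_zero (a n)]
      refine (hc.comp ?_).const_mul _
      refine tendsto_atTop_mono (fun k => ?_) hN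
      nlinarith
  · refine Eventually.of_forall fun k n => ?_
    rw [norm_mul]
    exact mul_le_mul_of_nonneg_left (hC _) (norm_nonneg _)

/-- If `E` is invariant under `z ↦ z ^ p` and some element of `A⁺` is flat on `E` without
vanishing at the origin, then `J₀⁺(E)` is weak-star dense. -/
lemma wStarDense_J0Plus_of_flat {E : Set ℂ} {p : ℕ} (hp : 1 < p) (hE : ∀ z ∈ E, z ^ p ∈ E)
    {g : ℂ → ℂ} (hg : g ∈ APlus) (hflat : VanishAllDeriv E g) (hg0 : g 0 ≠ 0) :
    WStarDense (J0Plus E) := by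
  obtain ⟨a, ha, hga⟩ := hg
  have ha0 : a 0 = g 0 := by
    have h1 := hga 0 (by simp)
    have h2 := hasSum_single (f := fun n => a n * (0 : ℂ) ^ n) 0 (fun n hn => by simp [hn])
    simpa using h2.unique h1
  have hEk : ∀ k, ∀ z ∈ E, z ^ p ^ k ∈ E := by
    intro k
    induction k with
    | zero => simp
    | succ k ih =>
      intro z hz
      rw [pow_succ, pow_mul]
      exact hE _ (ih z hz)
  have hpk : ∀ k, p ^ k ≠ 0 := fun k => pow_ne_zero _ (by omega)
  intro f hf m c hc ε hε
  obtain ⟨b, hb, hfb⟩ := hf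
  have hM : ∀ i, Tendsto (fun M => ∑ m ∈ Finset.range M, b m * c i m) atTop
      (nhds (pairing f (c i))) := by
    intro i
    obtain ⟨C, hC⟩ := exists_norm_le_of_tendsto_zero (hc i)
    rw [pairing, taylorCoeff_of_hasSum_closedBall hfb]
    exact (summable_mul_of_bounded hb hC).hasSum.tendsto_sum_nat
  obtain ⟨M, hM⟩ := (eventually_all.2 fun i =>
    Metric.tendsto_nhds.1 (hM i) (ε / 2) (half_pos hε)).exists
  set Q : Polynomial ℂ := ∑ j ∈ Finset.range M, Polynomial.C (b j / a 0) * Polynomial.X ^ j with hQ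
  set r : ℕ → ℕ → ℂ := fun k j => ∑ m ∈ Finset.range M,
    b m / a 0 * Function.extend (fun n => n * p ^ k + m) a 0 j with hr
  have hsum : ∀ k, ∀ z ∈ Metric.closedBall (0 : ℂ) 1,
      HasSum (fun j => r k j * z ^ j) (Q.eval z * g (z ^ p ^ k)) := by
    intro k z hz
    have := hasSum_sum (s := Finset.range M) fun m _ =>
      (hasSum_shifted_dilate (hpk k) hga m hz).mul_left (b m / a 0)
    have h1 : (fun j => r k j * z ^ j) = fun j => ∑ m ∈ Finset.range M, b m / a 0 *
        (Function.extend (fun n => n * p ^ k + m) a 0 j * z ^ j) := by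
      ext j
      rw [hr, Finset.sum_mul]
      exact Finset.sum_congr rfl fun _ _ => by ring
    have h2 : Q.eval z * g (z ^ p ^ k) =
        ∑ m ∈ Finset.range M, b m / a 0 * (z ^ m * g (z ^ p ^ k)) := by
      rw [hQ, Polynomial.eval_finsetSum, Finset.sum_mul]
      exact Finset.sum_congr rfl fun _ _ => by simp; ring
    rw [h1, h2]
    exact this
  have hpair : ∀ k i, pairing (fun z => Q.eval z * g (z ^ p ^ k)) (c i) =
      ∑ m ∈ Finset.range M, b m / a 0 * ∑' n, a n * c i (n * p ^ k + m) := by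
    intro k i
    rw [pairing, taylorCoeff_of_hasSum_closedBall (hsum k)]
    have := hasSum_sum (s := Finset.range M) fun m _ =>
      (hasSum_extend_mul ha (hc i) (hpk k) m).mul_left (b m / a 0)
    rw [← this.tsum_eq]
    congr 1
    ext j
    rw [hr, Finset.sum_mul]
    exact Finset.sum_congr rfl fun _ _ => by ring
  have hk : ∀ i, Tendsto (fun k => pairing (fun z => Q.eval z * g (z ^ p ^ k)) (c i)) atTop
      (nhds (∑ m ∈ Finset.range M, b m * c i m)) := by
    intro i
    simp only [hpair]
    refine tendsto_finsetSum _ fun m _ => ?_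
    have := (tendsto_tsum_dilate ha (hc i)
      (tendsto_pow_atTop_atTop_of_one_lt hp) m).const_mul (b m / a 0)
    convert this using 2
    rw [← mul_assoc, div_mul_cancel₀ _ (ha0 ▸ hg0)]
  obtain ⟨k, hk⟩ := (eventually_all.2 fun i =>
    Metric.tendsto_nhds.1 (hk i) (ε / 2) (half_pos hε)).exists
  have hGA : (fun z => Q.eval z * g (z ^ p ^ k)) ∈ APlus :=
    ⟨r k, summable_norm_of_hasSum_closedBall (hsum k), hsum k⟩
  refine ⟨fun z => Q.eval z * g (z ^ p ^ k), ⟨hGA, fun ε hε => ⟨_, hGA, ⟨?_, ?_, ?_, ?_⟩, ?_⟩⟩,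
    fun i => ?_⟩
  · exact Q.continuous.continuousOn.mul (hflat.1.comp (continuous_pow _).continuousOn
      fun z hz => pow_mem_unit_closedBall _ hz)
  · exact Q.differentiable.differentiableOn.mul (hflat.2.1.comp
      (differentiable_pow _).differentiableOn fun z hz => pow_mem_unit_ball (hpk k) hz)
  · intro z hz
    simp [hflat.2.2.1 _ (hEk k z hz)]
  · exact fun n => flat_polynomial_mul_comp_pow (hpk k) (hEk k) n g Q hflat.2.1 hflat.2.2.2
  · rw [sub_self]
    have : taylorCoeff (0 : ℂ → ℂ) = fun _ => 0 :=
      taylorCoeff_of_hasSum_closedBall fun z _ => by simp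
    simpa [APlusNorm, this] using hε
  · have h1 := hM i
    have h2 := hk i
    rw [← dist_eq_norm]
    exact (dist_triangle_right _ _ (∑ m ∈ Finset.range M, b m * c i m)).trans_lt
      ((add_lt_add (by rwa [dist_comm]) h2).trans_eq (add_halves ε))

lemma norm_taylorCoeff_le {H : ℂ → ℂ} {M : ℝ} (hH : DifferentiableOn ℂ H (Metric.ball 0 1))
    (hM : ∀ z ∈ Metric.ball (0 : ℂ) 1, ‖H z‖ ≤ M) (n : ℕ) : ‖taylorCoeff H n‖ ≤ M := by
  have key : ∀ᶠ R in nhdsWithin (1 : ℝ) (Set.Iio 1), ‖taylorCoeff H n‖ * R ^ n ≤ M := by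
    filter_upwards [Ioo_mem_nhdsLT (zero_lt_one (α := ℝ))] with R hR
    have hsub : Metric.closedBall (0 : ℂ) R ⊆ Metric.ball 0 1 :=
      Metric.closedBall_subset_ball hR.2
    have h1 := Complex.norm_iteratedDeriv_le_of_forall_mem_sphere_norm_le (f := H) (c := 0)
      (C := M) n hR.1 ((hH.mono hsub).diffContOnCl_ball subset_rfl)
      fun z hz => hM z (hsub (Metric.sphere_subset_closedBall hz))
    have hf : (0 : ℝ) < n.factorial := by positivity
    rw [le_div_iff₀ (pow_pos hR.1 n)] at h1
    rw [taylorCoeff, norm_div, Complex.norm_natCast, div_mul_eq_mul_div, div_le_iff₀ hf]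
    linarith
  have hlim : Tendsto (fun R : ℝ => ‖taylorCoeff H n‖ * R ^ n) (nhdsWithin 1 (Set.Iio 1))
      (nhds ‖taylorCoeff H n‖) := by
    have : ContinuousAt (fun R : ℝ => ‖taylorCoeff H n‖ * R ^ n) 1 := by fun_prop
    simpa using this.tendsto.mono_left nhdsWithin_le_nhds
  exact le_of_tendsto hlim key

lemma differentiableOn_iteratedDeriv {G : ℂ → ℂ} {U : Set ℂ} (hU : IsOpen U)
    (hG : DifferentiableOn ℂ G U) (k : ℕ) : DifferentiableOn ℂ (iteratedDeriv k G) U := by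
  induction k with
  | zero => simpa using hG
  | succ k ih =>
    rw [iteratedDeriv_succ]
    exact ih.deriv hU

lemma taylorCoeff_iteratedDeriv_add_two (G : ℂ → ℂ) (k n : ℕ) :
    taylorCoeff (iteratedDeriv (k + 2) G) n =
      taylorCoeff (iteratedDeriv k G) (n + 2) * ((n + 1) * (n + 2)) := by
  have h : iteratedDeriv n (iteratedDeriv (k + 2) G) =
      iteratedDeriv (n + 2) (iteratedDeriv k G) := by
    simp only [iteratedDeriv_eq_iterate, ← Function.iterate_add_apply]
    rw [show n + (k + 2) = n + 2 + k by omega]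
  have h1 : (n.factorial : ℂ) ≠ 0 := by exact_mod_cast n.factorial_ne_zero
  have h2 : (n : ℂ) + 1 ≠ 0 := by exact_mod_cast n.succ_ne_zero
  have h3 : (n : ℂ) + 2 ≠ 0 := by exact_mod_cast (n + 1).succ_ne_zero
  rw [taylorCoeff, taylorCoeff, h, Nat.factorial_succ, Nat.factorial_succ]
  push_cast
  rw [show (n : ℂ) + 1 + 1 = n + 2 by ring]
  field_simp

lemma summable_norm_taylorCoeff {G : ℂ → ℂ} (hG : DifferentiableOn ℂ G (Metric.ball 0 1)) {k : ℕ}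
    {M : ℝ} (hM : ∀ z ∈ Metric.ball (0 : ℂ) 1, ‖iteratedDeriv (k + 2) G z‖ ≤ M) :
    Summable fun n => ‖taylorCoeff (iteratedDeriv k G) n‖ := by
  rw [← summable_nat_add_iff 2]
  have hs : Summable fun n : ℕ => M * (1 / ((n + 1 : ℕ) : ℝ) ^ 2) :=
    ((summable_nat_add_iff 1).2 (Real.summable_one_div_nat_pow.2 one_lt_two)).mul_left M
  refine Summable.of_nonneg_of_le (fun _ => norm_nonneg _) (fun n => ?_) hs
  have h1 := norm_taylorCoeff_le
    (differentiableOn_iteratedDeriv Metric.isOpen_ball hG (k + 2)) hM n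
  rw [taylorCoeff_iteratedDeriv_add_two, norm_mul] at h1
  have h2 : ‖((n : ℂ) + 1) * (n + 2)‖ = ((n : ℝ) + 1) * (n + 2) := by
    have : ((n : ℂ) + 1) * (n + 2) = (((n + 1) * (n + 2) : ℕ) : ℂ) := by push_cast; ring
    rw [this, Complex.norm_natCast]
    push_cast
    ring
  rw [h2] at h1
  rw [mul_one_div, le_div_iff₀ (by positivity)]
  refine le_trans ?_ h1
  push_cast
  gcongr
  nlinarith [(Nat.cast_nonneg n : (0 : ℝ) ≤ n)]

/-- A holomorphic function on the disk all of whose derivatives are dominated by the distance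
to a subset `E` of the circle extends to an element of `A⁺` which is flat on `E`. -/
lemma exists_flat_of_iteratedDeriv_le {E : Set ℂ} (hne : E.Nonempty)
    (hE : E ⊆ Metric.sphere (0 : ℂ) 1) {G : ℂ → ℂ} (hG : DifferentiableOn ℂ G (Metric.ball 0 1))
    (hb : ∀ k, ∃ C : ℝ, ∀ z ∈ Metric.ball (0 : ℂ) 1,
      ‖iteratedDeriv k G z‖ ≤ C * Metric.infDist z E) :
    ∃ g ∈ APlus, VanishAllDeriv E g ∧ g 0 = G 0 := by
  obtain ⟨e, he⟩ := hne
  have hbd : ∀ k, ∃ M : ℝ, ∀ z ∈ Metric.ball (0 : ℂ) 1, ‖iteratedDeriv k G z‖ ≤ M := by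
    intro k
    obtain ⟨C, hC⟩ := hb k
    refine ⟨|C| * 2, fun z hz => (hC z hz).trans ?_⟩
    have h1 : Metric.infDist z E ≤ 2 := by
      refine (Metric.infDist_le_dist_of_mem he).trans ?_
      have h2 := dist_triangle z 0 e
      have h3 := Metric.mem_ball.1 hz
      have h4 := Metric.mem_sphere.1 (hE he)
      rw [dist_comm] at h4
      linarith
    exact mul_le_mul (le_abs_self C) h1 Metric.infDist_nonneg (abs_nonneg C)
  have hsum : ∀ k, Summable fun n => ‖taylorCoeff (iteratedDeriv k G) n‖ := fun k =>
    (hbd (k + 2)).elim fun M hM => summable_norm_taylorCoeff hG hM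
  set F : ℕ → ℂ → ℂ := fun k z => ∑' n, taylorCoeff (iteratedDeriv k G) n * z ^ n with hF
  have hle : ∀ k n, ∀ z ∈ Metric.closedBall (0 : ℂ) 1,
      ‖taylorCoeff (iteratedDeriv k G) n * z ^ n‖ ≤ ‖taylorCoeff (iteratedDeriv k G) n‖ := by
    intro k n z hz
    rw [norm_mul, norm_pow]
    exact mul_le_of_le_one_right (norm_nonneg _)
      (pow_le_one₀ (norm_nonneg _) (mem_closedBall_zero_iff.1 hz))
  have hcont : ∀ k, ContinuousOn (F k) (Metric.closedBall 0 1) := fun k =>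
    continuousOn_tsum (fun n => by fun_prop) (hsum k) (hle k)
  have hsumF : ∀ k, ∀ z ∈ Metric.closedBall (0 : ℂ) 1,
      HasSum (fun n => taylorCoeff (iteratedDeriv k G) n * z ^ n) (F k z) := fun k z hz =>
    (Summable.of_norm_bounded (hsum k) fun n => hle k n z hz).hasSum
  have heq : ∀ k, Set.EqOn (F k) (iteratedDeriv k G) (Metric.ball 0 1) := by
    intro k z hz
    have h1 := Complex.hasSum_taylorSeries_on_ball
      (differentiableOn_iteratedDeriv Metric.isOpen_ball hG k) hz
    have e : (fun n => taylorCoeff (iteratedDeriv k G) n * z ^ n) = fun n : ℕ =>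
        (n.factorial : ℂ)⁻¹ • (z - 0) ^ n • iteratedDeriv n (iteratedDeriv k G) 0 := by
      ext n
      rw [taylorCoeff, sub_zero, smul_eq_mul, smul_eq_mul]
      ring
    rw [← e] at h1
    exact (hsumF k z (Metric.ball_subset_closedBall hz)).unique h1
  have hzero : ∀ k, ∀ w ∈ E, F k w = 0 := by
    intro k w hw
    obtain ⟨C, hC⟩ := hb k
    have hw1 : ‖w‖ = 1 := by simpa using hE hw
    have hpath : Tendsto (fun t : ℝ => (t : ℂ) * w) (nhdsWithin 1 (Set.Iio 1))
        (nhdsWithin w (Metric.closedBall 0 1)) := by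
      refine tendsto_nhdsWithin_iff.2 ⟨?_, ?_⟩
      · have : ContinuousAt (fun t : ℝ => (t : ℂ) * w) 1 := by fun_prop
        simpa using this.tendsto.mono_left nhdsWithin_le_nhds
      · filter_upwards [Ioo_mem_nhdsLT (zero_lt_one (α := ℝ))] with t ht
        rw [mem_closedBall_zero_iff, norm_mul, hw1, mul_one, Complex.norm_of_nonneg ht.1.le]
        exact ht.2.le
    have h1 := (hcont k w (Metric.sphere_subset_closedBall (hE hw))).tendsto.comp hpath
    have h2 : Tendsto (fun t : ℝ => |C| * (1 - t)) (nhdsWithin 1 (Set.Iio 1)) (nhds 0) := by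
      have : ContinuousAt (fun t : ℝ => |C| * (1 - t)) 1 := by fun_prop
      simpa using this.tendsto.mono_left nhdsWithin_le_nhds
    refine tendsto_nhds_unique h1 (squeeze_zero_norm' ?_ h2)
    filter_upwards [Ioo_mem_nhdsLT (zero_lt_one (α := ℝ))] with t ht
    have hball : (t : ℂ) * w ∈ Metric.ball (0 : ℂ) 1 := by
      rw [mem_ball_zero_iff, norm_mul, hw1, mul_one, Complex.norm_of_nonneg ht.1.le]
      exact ht.2
    have hd : Metric.infDist ((t : ℂ) * w) E ≤ 1 - t := by
      refine (Metric.infDist_le_dist_of_mem hw).trans_eq ?_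
      have : (t : ℂ) * w - w = -(((1 - t : ℝ) : ℂ) * w) := by push_cast; ring
      rw [dist_eq_norm, this, norm_neg, norm_mul, hw1, mul_one,
        Complex.norm_of_nonneg (by linarith [ht.2])]
    rw [Function.comp_apply, heq k hball]
    exact (hC _ hball).trans (mul_le_mul (le_abs_self C) hd Metric.infDist_nonneg (abs_nonneg C))
  have heq0 : Set.EqOn (F 0) G (Metric.ball 0 1) := by simpa using heq 0
  refine ⟨F 0, ⟨_, hsum 0, hsumF 0⟩, ⟨hcont 0, hG.congr heq0, hzero 0, fun k =>
    ⟨F k, hcont k, fun z hz => ?_, hzero k⟩⟩, heq0 (by simp)⟩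
  rw [heq k hz, heq0.iteratedDeriv_of_isOpen Metric.isOpen_ball k hz]

lemma exists_pow_mul_exp_neg_le {c q A : ℝ} (hc : 0 < c) (hq : 1 < q) (hA : 0 ≤ A) :
    ∃ C : ℝ, ∀ n : ℕ, A ^ (n + 1) * Real.exp (-(c * q ^ n)) ≤ C := by
  obtain ⟨L, hL⟩ := pow_unbounded_of_one_lt A hq
  refine ⟨A * (L.factorial / c ^ L), fun n => ?_⟩
  have hx : 0 ≤ c * q ^ n := by positivity
  have h1 := Real.pow_div_factorial_le_exp _ hx L
  have hf : (0 : ℝ) < L.factorial := by positivity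
  rw [div_le_iff₀ hf, mul_pow] at h1
  have h2 : A ^ n ≤ (q ^ n) ^ L := by
    rw [← pow_mul, mul_comm, pow_mul]
    exact pow_le_pow_left₀ hA hL.le n
  have h3 : A ^ n ≤ L.factorial / c ^ L * Real.exp (c * q ^ n) := by
    rw [div_mul_eq_mul_div, le_div_iff₀ (by positivity)]
    nlinarith [mul_le_mul_of_nonneg_left h2 (pow_pos hc L).le]
  rw [Real.exp_neg, pow_succ', mul_assoc]
  refine mul_le_mul_of_nonneg_left ?_ hA
  rwa [← div_eq_mul_inv, div_le_iff₀ (Real.exp_pos _)]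

/-- If `Re h` is large near `E`, at a rate comparable to a power of the distance to `E`, then all
derivatives of `exp (-h)` are dominated by the distance to `E`. -/
lemma iteratedDeriv_exp_neg_le {E : Set ℂ} {h : ℂ → ℂ} {c q P : ℝ} (hc : 0 < c) (hq : 1 < q)
    (hP : 0 < P) (hh : ∀ z₀ ∈ Metric.ball (0 : ℂ) 1, ∃ n : ℕ,
      (P⁻¹) ^ (n + 1) < Metric.infDist z₀ E ∧
      DifferentiableOn ℂ h (Metric.ball z₀ (Metric.infDist z₀ E / 3)) ∧
      ∀ z ∈ Metric.ball z₀ (Metric.infDist z₀ E / 3), c * q ^ n ≤ (h z).re) (k : ℕ) :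
    ∃ C : ℝ, ∀ z ∈ Metric.ball (0 : ℂ) 1,
      ‖iteratedDeriv k (fun z => Complex.exp (-h z)) z‖ ≤ C * Metric.infDist z E := by
  obtain ⟨C, hC⟩ := exists_pow_mul_exp_neg_le hc hq (pow_pos hP (k + 1)).le
  refine ⟨k.factorial * C * 4 ^ k, fun z₀ hz₀ => ?_⟩
  obtain ⟨n, hn, hd, hre⟩ := hh z₀ hz₀
  set d := Metric.infDist z₀ E
  have hd0 : 0 < d := lt_trans (by positivity) hn
  have hsub : Metric.closedBall z₀ (d / 4) ⊆ Metric.ball z₀ (d / 3) :=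
    Metric.closedBall_subset_ball (by linarith)
  have h1 := Complex.norm_iteratedDeriv_le_of_forall_mem_sphere_norm_le
    (f := fun z => Complex.exp (-h z)) (c := z₀) (R := d / 4)
    (C := Real.exp (-(c * q ^ n))) k (by positivity)
    (((hd.mono hsub).neg.cexp).diffContOnCl_ball subset_rfl)
    (fun z hz => by
      rw [Complex.norm_exp, Complex.neg_re]
      exact Real.exp_le_exp.2 (neg_le_neg (hre z (hsub (Metric.sphere_subset_closedBall hz)))))
  refine h1.trans ?_
  rw [div_le_iff₀ (by positivity)]
  have h2 : Real.exp (-(c * q ^ n)) ≤ C * d ^ (k + 1) := by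
    have h3 := hC n
    have h4 : ((P ^ (k + 1)) ^ (n + 1))⁻¹ ≤ d ^ (k + 1) := by
      have : ((P ^ (k + 1)) ^ (n + 1))⁻¹ = (P⁻¹ ^ (n + 1)) ^ (k + 1) := by
        rw [inv_pow, inv_pow, ← pow_mul, ← pow_mul, mul_comm]
      rw [this]
      exact pow_le_pow_left₀ (by positivity) hn.le _
    have hC0 : 0 ≤ C := le_trans (by positivity) h3
    calc Real.exp (-(c * q ^ n)) ≤ C * ((P ^ (k + 1)) ^ (n + 1))⁻¹ := by
          rw [← div_eq_mul_inv, le_div_iff₀ (by positivity)]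
          linarith
      _ ≤ C * d ^ (k + 1) := mul_le_mul_of_nonneg_left h4 hC0
  calc k.factorial * Real.exp (-(c * q ^ n)) ≤ k.factorial * (C * d ^ (k + 1)) := by gcongr
    _ = k.factorial * C * 4 ^ k * d * (d / 4) ^ k := by
      rw [div_pow]
      field_simp
      ring

lemma sector_of_near {u u₀ : ℂ} (h0 : 0 ≤ u₀.re) (h : ‖u - u₀‖ ≤ ‖u₀‖ / 3) :
    2 / 3 * ‖u₀‖ ≤ ‖u‖ ∧ ‖u‖ ≤ 4 / 3 * ‖u₀‖ ∧ -(‖u‖ / 2) ≤ u.re := by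
  have h1 : ‖u₀‖ ≤ ‖u‖ + ‖u - u₀‖ := by
    rw [norm_sub_rev]
    simpa using norm_add_le u (u₀ - u)
  have h2 : ‖u‖ ≤ ‖u₀‖ + ‖u - u₀‖ := by simpa using norm_add_le u₀ (u - u₀)
  have h3 := (abs_le.1 (Complex.abs_re_le_norm (u - u₀))).1
  rw [Complex.sub_re] at h3
  refine ⟨by linarith, by linarith, by linarith⟩

lemma cos_pi_sector_pos : 0 < Real.cos (7 * Real.pi / 15) :=
  Real.cos_pos_of_mem_Ioo ⟨by linarith [Real.pi_pos], by linarith [Real.pi_pos]⟩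

lemma le_re_cpow_of_sector {u : ℂ} (hu : 0 < ‖u‖) (h : -(‖u‖ / 2) ≤ u.re) :
    u ∈ Complex.slitPlane ∧ Real.cos (7 * Real.pi / 15) * ‖u‖ ^ (-(7 / 10) : ℝ) ≤
      (u ^ ((-(7 / 10) : ℝ) : ℂ)).re := by
  have hu0 : u ≠ 0 := norm_pos_iff.1 hu
  have hpi := Real.pi_pos
  have harg : |u.arg| ≤ 2 * Real.pi / 3 := by
    by_contra! hlt
    have h1 := Real.cos_lt_cos_of_nonneg_of_le_pi (by positivity) (Complex.abs_arg_le_pi u) hlt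
    rw [Real.cos_abs, Complex.cos_arg hu0,
      show 2 * Real.pi / 3 = Real.pi - Real.pi / 3 by ring, Real.cos_pi_sub, Real.cos_pi_div_three,
      div_lt_iff₀ hu] at h1
    linarith
  refine ⟨Complex.mem_slitPlane_iff_arg.2 ⟨fun h => ?_, hu0⟩, ?_⟩
  · rw [h, abs_of_pos hpi] at harg
    linarith
  · rw [Complex.cpow_def_of_ne_zero hu0, Complex.exp_re, Complex.re_mul_ofReal,
      Complex.im_mul_ofReal, Complex.log_re, Complex.log_im, Real.rpow_def_of_pos hu, mul_comm]
    refine mul_le_mul_of_nonneg_left ?_ (Real.exp_pos _).le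
    rw [← Real.cos_abs (u.arg * _), abs_mul]
    refine Real.cos_le_cos_of_nonneg_of_le_pi (by positivity) (by linarith) ?_
    rw [abs_neg, abs_of_pos (by norm_num : (0 : ℝ) < 7 / 10)]
    linarith

/-- A series of fractional powers with singularities at the points `w j` of the circle. -/
def fracPowSeries (w : ℕ → ℂ) (z : ℂ) : ℂ :=
  ∑' j : ℕ, ((((j : ℝ) + 1) ^ (-(11 / 10) : ℝ) : ℝ) : ℂ) *
    (1 - z * starRingEnd ℂ (w j)) ^ ((-(7 / 10) : ℝ) : ℂ)

lemma summable_weights : Summable fun j : ℕ => ((j : ℝ) + 1) ^ (-(11 / 10) : ℝ) := by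
  have := (summable_nat_add_iff 1).2 (Real.summable_nat_rpow.2 (by norm_num : (-(11 / 10) : ℝ) < -1))
  simpa using this

lemma one_sub_mul_conj_bounds {v z z₀ : ℂ} {d : ℝ} (hv : ‖v‖ = 1)
    (hz₀ : z₀ ∈ Metric.ball (0 : ℂ) 1) (hdv : d ≤ dist z₀ v) (hz : z ∈ Metric.ball z₀ (d / 3)) :
    2 / 3 * d ≤ ‖1 - z * starRingEnd ℂ v‖ ∧
      ‖1 - z * starRingEnd ℂ v‖ ≤ 4 / 3 * dist z₀ v ∧
      -(‖1 - z * starRingEnd ℂ v‖ / 2) ≤ (1 - z * starRingEnd ℂ v).re := by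
  have hvc : ‖starRingEnd ℂ v‖ = 1 := by rw [Complex.norm_conj, hv]
  have hvv : v * starRingEnd ℂ v = 1 := by
    rw [Complex.mul_conj, Complex.normSq_eq_norm_sq, hv]
    simp
  have h0 : ‖1 - z₀ * starRingEnd ℂ v‖ = dist z₀ v := by
    rw [← hvv, ← sub_mul, norm_mul, hvc, mul_one, dist_comm, dist_eq_norm]
  have h1 : ‖(1 - z * starRingEnd ℂ v) - (1 - z₀ * starRingEnd ℂ v)‖ = dist z z₀ := by
    rw [sub_sub_sub_cancel_left, ← sub_mul, norm_mul, hvc, mul_one, dist_comm, dist_eq_norm]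
  have h2 : 0 ≤ (1 - z₀ * starRingEnd ℂ v).re := by
    have := (Complex.re_le_norm (z₀ * starRingEnd ℂ v))
    rw [norm_mul, hvc, mul_one] at this
    rw [Complex.sub_re, Complex.one_re]
    linarith [mem_ball_zero_iff.1 hz₀]
  obtain ⟨ha, hb, hc⟩ := sector_of_near h2
    (by rw [h0, h1]; linarith [Metric.mem_ball.1 hz])
  rw [h0] at ha hb
  exact ⟨by linarith, hb, hc⟩

lemma fracPowSeries_near {w : ℕ → ℂ} {z₀ : ℂ} {d : ℝ} (hw : ∀ j, ‖w j‖ = 1)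
    (hz₀ : z₀ ∈ Metric.ball (0 : ℂ) 1) (hd : 0 < d) (hdw : ∀ j, d ≤ dist z₀ (w j)) :
    DifferentiableOn ℂ (fracPowSeries w) (Metric.ball z₀ (d / 3)) ∧
    ∀ z ∈ Metric.ball z₀ (d / 3), ∀ j : ℕ,
      ((j : ℝ) + 1) ^ (-(11 / 10) : ℝ) *
        (Real.cos (7 * Real.pi / 15) * (4 / 3 * dist z₀ (w j)) ^ (-(7 / 10) : ℝ)) ≤
        (fracPowSeries w z).re := by
  have hb := fun j z (hz : z ∈ Metric.ball z₀ (d / 3)) =>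
    one_sub_mul_conj_bounds (hw j) hz₀ (hdw j) hz
  have hpos : ∀ j, ∀ z ∈ Metric.ball z₀ (d / 3), 0 < ‖1 - z * starRingEnd ℂ (w j)‖ :=
    fun j z hz => lt_of_lt_of_le (by positivity) (hb j z hz).1
  have hsec := fun j z (hz : z ∈ Metric.ball z₀ (d / 3)) =>
    le_re_cpow_of_sector (hpos j z hz) (hb j z hz).2.2
  have hwt : ∀ j : ℕ, 0 ≤ ((j : ℝ) + 1) ^ (-(11 / 10) : ℝ) := fun j => by positivity
  have hsum := summable_weights.mul_right ((2 / 3 * d) ^ (-(7 / 10) : ℝ))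
  have hle : ∀ (j : ℕ), ∀ z ∈ Metric.ball z₀ (d / 3),
      ‖((((j : ℝ) + 1) ^ (-(11 / 10) : ℝ) : ℝ) : ℂ) *
        (1 - z * starRingEnd ℂ (w j)) ^ ((-(7 / 10) : ℝ) : ℂ)‖ ≤
      ((j : ℝ) + 1) ^ (-(11 / 10) : ℝ) * (2 / 3 * d) ^ (-(7 / 10) : ℝ) := by
    intro j z hz
    rw [norm_mul, Complex.norm_of_nonneg (hwt j), Complex.norm_cpow_real]
    exact mul_le_mul_of_nonneg_left
      (Real.rpow_le_rpow_of_nonpos (by positivity) (hb j z hz).1 (by norm_num)) (hwt j)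
  refine ⟨Complex.differentiableOn_tsum_of_summable_norm hsum (fun j => ?_) Metric.isOpen_ball hle,
    fun z hz j => ?_⟩
  · refine DifferentiableOn.const_mul (fun z hz => ?_) _
    have hlin : DifferentiableAt ℂ (fun z => 1 - z * starRingEnd ℂ (w j)) z := by fun_prop
    exact (hlin.cpow (differentiableAt_const _) (hsec j z hz).1).differentiableWithinAt
  · have hs := Summable.of_norm_bounded hsum fun j => hle j z hz
    have hre : ∀ j : ℕ, ((j : ℝ) + 1) ^ (-(11 / 10) : ℝ) * (Real.cos (7 * Real.pi / 15) *
        ‖1 - z * starRingEnd ℂ (w j)‖ ^ (-(7 / 10) : ℝ)) ≤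
        (((((j : ℝ) + 1) ^ (-(11 / 10) : ℝ) : ℝ) : ℂ) *
          (1 - z * starRingEnd ℂ (w j)) ^ ((-(7 / 10) : ℝ) : ℂ)).re := by
      intro j
      rw [Complex.re_ofReal_mul]
      exact mul_le_mul_of_nonneg_left (hsec j z hz).2 (hwt j)
    have hκ := cos_pi_sector_pos.le
    rw [fracPowSeries, Complex.re_tsum hs]
    refine le_trans ?_ ((Complex.hasSum_re hs.hasSum).summable.le_tsum j fun i _ =>
      le_trans (by positivity) (hre i))
    refine le_trans (mul_le_mul_of_nonneg_left (mul_le_mul_of_nonneg_left ?_ hκ) (hwt j)) (hre j)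
    exact Real.rpow_le_rpow_of_nonpos (hpos j z hz) (hb j z hz).2.1 (by norm_num)

lemma two_rpow_lt_three_rpow : (2 : ℝ) ^ (11 / 10 : ℝ) < 3 ^ (7 / 10 : ℝ) := by
  have h : ((2 : ℝ) ^ (11 / 10 : ℝ)) ^ 10 < (3 ^ (7 / 10 : ℝ)) ^ 10 := by
    rw [← Real.rpow_natCast, ← Real.rpow_natCast, ← Real.rpow_mul (by norm_num),
      ← Real.rpow_mul (by norm_num)]
    norm_num
  exact lt_of_pow_lt_pow_left₀ 10 (by positivity) h

/-- If each point of `E` is within `7 p ^ (-n)` of one of the first `2 ^ n` terms of a sequence in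
`E`, then there is an element of `A⁺`, flat on `E`, which does not vanish at the origin. -/
lemma exists_flat_of_approx {E : Set ℂ} (hne : E.Nonempty) (hE : E ⊆ Metric.sphere (0 : ℂ) 1)
    {P : ℝ} (hP : 3 ≤ P) {w : ℕ → ℂ} (hwE : ∀ j, w j ∈ E)
    (happ : ∀ e ∈ E, ∀ n : ℕ, ∃ j < 2 ^ n, dist e (w j) ≤ 7 * P⁻¹ ^ n) :
    ∃ g ∈ APlus, VanishAllDeriv E g ∧ g 0 ≠ 0 := by
  have hw : ∀ j, ‖w j‖ = 1 := fun j => by simpa using hE (hwE j)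
  have hdpos : ∀ z₀ ∈ Metric.ball (0 : ℂ) 1, 0 < Metric.infDist z₀ E := by
    intro z₀ hz₀
    have hz₁ := mem_ball_zero_iff.1 hz₀
    refine lt_of_lt_of_le (sub_pos.2 hz₁) ((Metric.le_infDist hne).2 fun e he => ?_)
    have : ‖e‖ = 1 := by simpa using hE he
    rw [dist_comm, dist_eq_norm, ← this]
    exact norm_sub_norm_le _ _
  have hdw : ∀ z₀ j, Metric.infDist z₀ E ≤ dist z₀ (w j) := fun z₀ j =>
    Metric.infDist_le_dist_of_mem (hwE j)
  have hκ := cos_pi_sector_pos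
  have hmain : ∀ z₀ ∈ Metric.ball (0 : ℂ) 1, ∃ n : ℕ,
      (P⁻¹) ^ (n + 1) < Metric.infDist z₀ E ∧
      DifferentiableOn ℂ (fracPowSeries w) (Metric.ball z₀ (Metric.infDist z₀ E / 3)) ∧
      ∀ z ∈ Metric.ball z₀ (Metric.infDist z₀ E / 3),
        ((2 : ℝ) ^ (-(11 / 10) : ℝ) * (Real.cos (7 * Real.pi / 15) * 16 ^ (-(7 / 10) : ℝ))) *
          (3 ^ (7 / 10 : ℝ) / 2 ^ (11 / 10 : ℝ)) ^ n ≤ (fracPowSeries w z).re := by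
    intro z₀ hz₀
    have hd := hdpos z₀ hz₀
    set d := Metric.infDist z₀ E with hd_def
    obtain ⟨hdiff, hre⟩ := fracPowSeries_near hw hz₀ hd (hdw z₀)
    have hd2 : d / 2 ≤ 1 := by
      have h1 := hdw z₀ 0
      have h2 := dist_triangle z₀ 0 (w 0)
      rw [dist_zero_left, hw, dist_zero_right] at h2
      linarith [mem_ball_zero_iff.1 hz₀]
    obtain ⟨n, hn1, hn2⟩ := exists_nat_pow_near_of_lt_one (half_pos hd) hd2
      (inv_pos.2 (by linarith : 0 < P)) (inv_lt_one_of_one_lt₀ (by linarith))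
    obtain ⟨e, he, hze⟩ := (Metric.infDist_lt_iff hne).1
      (show Metric.infDist z₀ E < 2 * d by rw [← hd_def]; linarith)
    obtain ⟨j, hj, hej⟩ := happ e he (n + 1)
    refine ⟨n, by linarith, hdiff, fun z hz => le_trans ?_ (hre z hz j)⟩
    have hzw : 0 < dist z₀ (w j) := lt_of_lt_of_le hd (hdw z₀ j)
    have hzw2 : 4 / 3 * dist z₀ (w j) ≤ 16 * ((3 : ℝ) ^ n)⁻¹ := by
      have h1 := dist_triangle z₀ e (w j)
      have h2 : P⁻¹ ^ n ≤ ((3 : ℝ) ^ n)⁻¹ := by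
        rw [inv_pow]
        gcongr
      linarith
    have h3 : (16 * ((3 : ℝ) ^ n)⁻¹) ^ (-(7 / 10) : ℝ) =
        16 ^ (-(7 / 10) : ℝ) * ((3 : ℝ) ^ (7 / 10 : ℝ)) ^ n := by
      rw [Real.mul_rpow (by positivity) (by positivity), Real.inv_rpow (by positivity),
        Real.rpow_neg (by positivity : (0 : ℝ) ≤ 3 ^ n), inv_inv, ← Real.rpow_natCast,
        ← Real.rpow_mul (by norm_num),
        ← Real.rpow_natCast, ← Real.rpow_mul (by norm_num), mul_comm (n : ℝ)]
    have h4 : ((2 : ℝ) ^ (n + 1)) ^ (-(11 / 10) : ℝ) =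
        (2 : ℝ) ^ (-(11 / 10) : ℝ) * (((2 : ℝ) ^ (11 / 10 : ℝ)) ^ n)⁻¹ := by
      rw [pow_succ', Real.mul_rpow (by positivity) (by positivity),
        Real.rpow_neg (by positivity : (0 : ℝ) ≤ 2 ^ n), ← Real.rpow_natCast,
        ← Real.rpow_mul (by norm_num), ← Real.rpow_natCast, ← Real.rpow_mul (by norm_num),
        mul_comm (n : ℝ)]
    have h5 : (2 : ℝ) ^ (-(11 / 10) : ℝ) * (((2 : ℝ) ^ (11 / 10 : ℝ)) ^ n)⁻¹ ≤
        ((j : ℝ) + 1) ^ (-(11 / 10) : ℝ) := by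
      rw [← h4]
      exact Real.rpow_le_rpow_of_nonpos (by positivity) (by exact_mod_cast hj) (by norm_num)
    have h6 : 16 ^ (-(7 / 10) : ℝ) * ((3 : ℝ) ^ (7 / 10 : ℝ)) ^ n ≤
        (4 / 3 * dist z₀ (w j)) ^ (-(7 / 10) : ℝ) := by
      rw [← h3]
      exact Real.rpow_le_rpow_of_nonpos (by positivity) hzw2 (by norm_num)
    calc _ = ((2 : ℝ) ^ (-(11 / 10) : ℝ) * (((2 : ℝ) ^ (11 / 10 : ℝ)) ^ n)⁻¹) *
          (Real.cos (7 * Real.pi / 15) *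
            (16 ^ (-(7 / 10) : ℝ) * ((3 : ℝ) ^ (7 / 10 : ℝ)) ^ n)) := by
          rw [div_pow]
          ring
      _ ≤ _ := by gcongr
  have hG : DifferentiableOn ℂ (fun z => Complex.exp (-fracPowSeries w z)) (Metric.ball 0 1) := by
    intro z₀ hz₀
    obtain ⟨n, -, hd, -⟩ := hmain z₀ hz₀
    exact ((hd.differentiableAt (Metric.ball_mem_nhds _
      (by linarith [hdpos z₀ hz₀]))).neg.cexp).differentiableWithinAt
  obtain ⟨g, hgA, hgE, hg0⟩ := exists_flat_of_iteratedDeriv_le hne hE hG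
    (iteratedDeriv_exp_neg_le (by positivity)
      ((one_lt_div (by positivity)).2 two_rpow_lt_three_rpow) (by linarith) hmain)
  exact ⟨g, hgA, hgE, by rw [hg0]; exact Complex.exp_ne_zero _⟩

/-- The point of the circle with angle `2π (1 - ξ) ∑ εₖ ξᵏ`. -/
def esetPoint (ξ : ℝ) (ε : ℕ → ℕ) : ℂ :=
  Complex.exp (2 * Real.pi * Complex.I * (((1 - ξ) * ∑' k : ℕ, (ε k : ℝ) * ξ ^ k : ℝ) : ℂ))

lemma summable_digits {ξ : ℝ} (h0 : 0 ≤ ξ) (h1 : ξ < 1) {ε : ℕ → ℕ} (hε : ∀ k, ε k ≤ 1) :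
    Summable fun k => (ε k : ℝ) * ξ ^ k := by
  refine Summable.of_nonneg_of_le (fun k => by positivity) (fun k => ?_)
    (summable_geometric_of_lt_one h0 h1)
  exact mul_le_of_le_one_left (by positivity) (by exact_mod_cast hε k)

lemma norm_esetPoint (ξ : ℝ) (ε : ℕ → ℕ) : ‖esetPoint ξ ε‖ = 1 := by
  have e : 2 * Real.pi * Complex.I * (((1 - ξ) * ∑' k, (ε k : ℝ) * ξ ^ k : ℝ) : ℂ) =
      ((2 * Real.pi * ((1 - ξ) * ∑' k, (ε k : ℝ) * ξ ^ k) : ℝ) : ℂ) * Complex.I := by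
    push_cast
    ring
  rw [esetPoint, e, Complex.norm_exp_ofReal_mul_I]

lemma esetPoint_pow {p : ℕ} (hp : 2 ≤ p) {ε : ℕ → ℕ} (hε : ∀ k, ε k ≤ 1) :
    esetPoint (1 / (p : ℝ)) ε ^ p = esetPoint (1 / (p : ℝ)) fun k => ε (k + 1) := by
  have hp' : (2 : ℝ) ≤ p := by exact_mod_cast hp
  have hp0 : (p : ℝ) ≠ 0 := by positivity
  set ξ : ℝ := 1 / (p : ℝ) with hξ
  have h1 : ξ < 1 := by
    rw [hξ, div_lt_one (by positivity)]
    linarith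
  have hs := (summable_digits (by positivity) h1 hε).tsum_eq_zero_add
  have hs2 : ∑' k, (ε (k + 1) : ℝ) * ξ ^ (k + 1) = ξ * ∑' k, (ε (k + 1) : ℝ) * ξ ^ k := by
    rw [← tsum_mul_left]
    exact tsum_congr fun k => by ring
  rw [hs2, pow_zero, mul_one] at hs
  set S := ∑' k, (ε (k + 1) : ℝ) * ξ ^ k
  have key : (p : ℝ) * ((1 - ξ) * (ε 0 + ξ * S)) =
      (((p : ℤ) - 1) * (ε 0 : ℤ) : ℤ) + (1 - ξ) * S := by
    rw [hξ]
    push_cast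
    field_simp
  rw [esetPoint, esetPoint, hs, ← Complex.exp_nat_mul]
  have e : (p : ℂ) * (2 * Real.pi * Complex.I * (((1 - ξ) * (ε 0 + ξ * S) : ℝ) : ℂ)) =
      2 * Real.pi * Complex.I * (((1 - ξ) * S : ℝ) : ℂ) +
        (((p : ℤ) - 1) * (ε 0 : ℤ) : ℤ) * (2 * Real.pi * Complex.I) := by
    have := congrArg (fun x : ℝ => (x : ℂ) * (2 * Real.pi * Complex.I)) key
    simp only [Complex.ofReal_add, Complex.ofReal_intCast, Complex.ofReal_mul (p : ℝ),
      Complex.ofReal_natCast] at this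
    linear_combination this
  rw [e, Complex.exp_add, Complex.exp_int_mul_two_pi_mul_I, mul_one]

lemma dist_esetPoint_le {ξ : ℝ} (h0 : 0 ≤ ξ) (h1 : ξ < 1) {ε δ : ℕ → ℕ} (hε : ∀ k, ε k ≤ 1)
    (hδ : ∀ k, δ k ≤ 1) {n : ℕ} (h : ∀ k < n, ε k = δ k) :
    dist (esetPoint ξ ε) (esetPoint ξ δ) ≤ 7 * ξ ^ n := by
  have hsε := summable_digits h0 h1 hε
  have hsδ := summable_digits h0 h1 hδ
  set x := (1 - ξ) * ∑' k, (ε k : ℝ) * ξ ^ k with hx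
  set y := (1 - ξ) * ∑' k, (δ k : ℝ) * ξ ^ k with hy
  have hxy : |x - y| ≤ ξ ^ n := by
    have e : ∑' k, (ε k : ℝ) * ξ ^ k - ∑' k, (δ k : ℝ) * ξ ^ k =
        ∑' k, ((ε (k + n) : ℝ) - δ (k + n)) * ξ ^ (k + n) := by
      rw [← hsε.tsum_sub hsδ, ← (hsε.sub hsδ).sum_add_tsum_nat_add n, Finset.sum_eq_zero, zero_add]
      · exact tsum_congr fun k => by ring
      · intro k hk
        rw [h k (Finset.mem_range.1 hk), sub_self]
    have hg : HasSum (fun k => ξ ^ (k + n)) ((1 - ξ)⁻¹ * ξ ^ n) := by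
      simpa only [pow_add] using (hasSum_geometric_of_lt_one h0 h1).mul_right (ξ ^ n)
    have hb := tsum_of_norm_bounded (f := fun k => ((ε (k + n) : ℝ) - δ (k + n)) * ξ ^ (k + n)) hg
      fun k => by
        rw [norm_mul, norm_pow, Real.norm_of_nonneg h0, Real.norm_eq_abs]
        refine mul_le_of_le_one_left (by positivity) (abs_le.2 ?_)
        have a1 : (ε (k + n) : ℝ) ≤ 1 := by exact_mod_cast hε _
        have a2 : (δ (k + n) : ℝ) ≤ 1 := by exact_mod_cast hδ _
        have a3 : (0 : ℝ) ≤ ε (k + n) := by positivity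
        have a4 : (0 : ℝ) ≤ δ (k + n) := by positivity
        constructor <;> linarith
    rw [hx, hy, ← mul_sub, e, abs_mul, abs_of_pos (sub_pos.2 h1)]
    refine (mul_le_mul_of_nonneg_left hb (sub_pos.2 h1).le).trans_eq ?_
    rw [← mul_assoc, mul_inv_cancel₀ (sub_pos.2 h1).ne', one_mul]
  have e : esetPoint ξ ε - esetPoint ξ δ =
      esetPoint ξ δ * (Complex.exp (Complex.I * ((2 * Real.pi * (x - y) : ℝ) : ℂ)) - 1) := by
    rw [mul_sub, mul_one, esetPoint, esetPoint, ← Complex.exp_add, ← hx, ← hy]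
    congr 2
    push_cast
    ring
  rw [dist_eq_norm, e, norm_mul, norm_esetPoint, one_mul]
  refine Real.norm_exp_I_mul_ofReal_sub_one_le.trans ?_
  rw [Real.norm_eq_abs, abs_mul, abs_of_pos (by positivity)]
  exact mul_le_mul (by linarith [Real.pi_lt_d2]) hxy (abs_nonneg _) (by norm_num)

lemma exists_testBit_eq {ε : ℕ → ℕ} (hε : ∀ k, ε k ≤ 1) (n : ℕ) :
    ∃ j < 2 ^ n, ∀ k < n, ε k = (j.testBit k).toNat := by
  refine ⟨Nat.ofBits fun k : Fin n => decide (ε k = 1), Nat.ofBits_lt_two_pow _, fun k hk => ?_⟩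
  rw [Nat.testBit_ofBits_lt _ k hk]
  have := hε k
  interval_cases h : ε k <;> simp


/-- For every integer `p ≥ 3`, `J₀⁺(E_{1/p})` is weak-star dense
in `A⁺`. -/
theorem stmt_9 (p : ℕ) (hp : 3 ≤ p) :
    WStarDense (J0Plus (Eset (1 / (p : ℝ)))) := by
  have hp' : (3 : ℝ) ≤ p := by exact_mod_cast hp
  have h0 : 0 ≤ 1 / (p : ℝ) := by positivity
  have h1 : 1 / (p : ℝ) < 1 := by
    rw [div_lt_one (by positivity)]
    linarith
  have hdig : ∀ j k : ℕ, (j.testBit k).toNat ≤ 1 := fun j k => Bool.toNat_le _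
  have hwE : ∀ j : ℕ, esetPoint (1 / (p : ℝ)) (fun k => (j.testBit k).toNat) ∈
      Eset (1 / (p : ℝ)) := fun j => ⟨_, hdig j, rfl⟩
  obtain ⟨g, hg, hflat, hg0⟩ := exists_flat_of_approx ⟨_, hwE 0⟩
    (by
      rintro _ ⟨ε, -, rfl⟩
      exact mem_sphere_zero_iff_norm.2 (norm_esetPoint _ ε))
    hp' hwE (by
      rintro _ ⟨ε, hε, rfl⟩ n
      obtain ⟨j, hj, hjε⟩ := exists_testBit_eq hε n
      rw [← one_div]
      exact ⟨j, hj, dist_esetPoint_le h0 h1 hε (hdig j) hjε⟩)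
  refine wStarDense_J0Plus_of_flat (by omega : 1 < p) ?_ hg hflat hg0
  rintro _ ⟨ε, hε, rfl⟩
  exact ⟨fun k => ε (k + 1), fun k => hε _, esetPoint_pow (by omega) hε⟩
end
end

section
/- Let K ⊆ Γ be a Helson set. Then I⁺(K) = {f ∈ A⁺ : f vanishes identically on K} is weak-star dense in A⁺. -/
noncomputable section

open Complex MeasureTheory Metric Set Filter

section TrigSums

variable {X : Type*} [TopologicalSpace X]

/-- The `n`-th power of a continuous circle-valued function, as a complex-valued function. -/
def circlePow (φ : C(X, Circle)) (n : ℤ) : C(X, ℂ) :=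
  ⟨fun x => ((φ x ^ n : Circle) : ℂ), continuous_induced_dom.comp (φ.continuous.zpow n)⟩

/-- `g` is a finite trigonometric sum in `φ` with frequencies in `S` and with coefficients of
total modulus at most `B`. -/
def IsTrigSum (φ : C(X, Circle)) (S : Set ℤ) (B : ℝ) (g : C(X, ℂ)) : Prop :=
  ∃ (ι : Type) (s : Finset ι) (a : ι → ℂ) (ν : ι → ℤ), (∀ i ∈ s, ν i ∈ S) ∧
    ∑ i ∈ s, ‖a i‖ ≤ B ∧ g = ∑ i ∈ s, a i • circlePow φ (ν i)

variable {φ : C(X, Circle)} {S S' : Set ℤ} {B B' : ℝ} {g g' : C(X, ℂ)}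

lemma circlePow_add (m n : ℤ) : circlePow φ (m + n) = circlePow φ m * circlePow φ n := by
  ext x; simp [circlePow, zpow_add]

lemma star_circlePow (n : ℤ) : star (circlePow φ n) = circlePow φ (-n) := by
  ext x; simp [circlePow, ← Circle.coe_inv_eq_conj]

lemma norm_circlePow_apply (n : ℤ) (x : X) : ‖circlePow φ n x‖ = 1 :=
  Circle.norm_coe _

lemma norm_circlePow_le [CompactSpace X] (n : ℤ) : ‖circlePow φ n‖ ≤ 1 :=
  (ContinuousMap.norm_le _ zero_le_one).2 fun x => (norm_circlePow_apply n x).le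

namespace IsTrigSum

lemma mono (h : IsTrigSum φ S B g) (hS : S ⊆ S') (hB : B ≤ B') : IsTrigSum φ S' B' g := by
  obtain ⟨ι, s, a, ν, h1, h2, h3⟩ := h
  exact ⟨ι, s, a, ν, fun i hi => hS (h1 i hi), h2.trans hB, h3⟩

lemma zero : IsTrigSum φ S 0 0 := ⟨ℕ, ∅, 0, 0, by simp⟩

lemma bound_nonneg (h : IsTrigSum φ S B g) : 0 ≤ B := by
  obtain ⟨ι, s, a, ν, h1, h2, h3⟩ := h
  exact (Finset.sum_nonneg fun _ _ => norm_nonneg _).trans h2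

lemma add (h : IsTrigSum φ S B g) (h' : IsTrigSum φ S B' g') :
    IsTrigSum φ S (B + B') (g + g') := by
  obtain ⟨ι, s, a, ν, h1, h2, h3⟩ := h
  obtain ⟨κ, t, b, μ, k1, k2, k3⟩ := h'
  refine ⟨ι ⊕ κ, s.disjSum t, Sum.elim a b, Sum.elim ν μ, ?_, ?_, ?_⟩
  · rintro (i | i) hi
    · exact h1 i (by simpa using hi)
    · exact k1 i (by simpa using hi)
  · simpa using add_le_add h2 k2
  · simp [h3, k3]

lemma smul (h : IsTrigSum φ S B g) (c : ℂ) : IsTrigSum φ S (‖c‖ * B) (c • g) := by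
  obtain ⟨ι, s, a, ν, h1, h2, h3⟩ := h
  refine ⟨ι, s, fun i => c * a i, ν, h1, ?_, ?_⟩
  · simp only [norm_mul, ← Finset.mul_sum]
    gcongr
  · simp [h3, Finset.smul_sum, mul_smul]

lemma mul {S'' : Set ℤ} (h : IsTrigSum φ S B g) (h' : IsTrigSum φ S' B' g')
    (hS : ∀ m ∈ S, ∀ n ∈ S', m + n ∈ S'') : IsTrigSum φ S'' (B * B') (g * g') := by
  have hB := h.bound_nonneg
  obtain ⟨ι, s, a, ν, h1, h2, h3⟩ := h
  obtain ⟨κ, t, b, μ, k1, k2, k3⟩ := h'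
  refine ⟨ι × κ, s ×ˢ t, fun p => a p.1 * b p.2, fun p => ν p.1 + μ p.2, ?_, ?_, ?_⟩
  · rintro ⟨i, j⟩ hp
    rw [Finset.mem_product] at hp
    exact hS _ (h1 i hp.1) _ (k1 j hp.2)
  · simp only [norm_mul]
    rw [Finset.sum_product, ← Finset.sum_mul_sum s t (fun i => ‖a i‖) (fun j => ‖b j‖)]
    exact mul_le_mul h2 k2 (Finset.sum_nonneg fun _ _ => norm_nonneg _) hB
  · rw [h3, k3, Finset.sum_mul_sum, Finset.sum_product]
    refine Finset.sum_congr rfl fun i _ => Finset.sum_congr rfl fun j _ => ?_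
    rw [circlePow_add, smul_mul_smul_comm]

lemma star (h : IsTrigSum φ S B g) (hS : ∀ n ∈ S, -n ∈ S') : IsTrigSum φ S' B (star g) := by
  obtain ⟨ι, s, a, ν, h1, h2, h3⟩ := h
  refine ⟨ι, s, fun i => Star.star (a i), fun i => -ν i, fun i hi => hS _ (h1 i hi), ?_, ?_⟩
  · simpa using h2
  · simp [h3, star_sum, star_smul, star_circlePow]

lemma norm_le [CompactSpace X] (h : IsTrigSum φ S B g) : ‖g‖ ≤ B := by
  obtain ⟨ι, s, a, ν, h1, h2, h3⟩ := h
  rw [h3]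
  refine (norm_sum_le _ _).trans ((Finset.sum_le_sum fun i _ => ?_).trans h2)
  rw [norm_smul]
  exact mul_le_of_le_one_right (norm_nonneg _) (norm_circlePow_le _)

lemma exists_Icc (h : IsTrigSum φ S B g) :
    ∃ M : ℕ, IsTrigSum φ (Icc (-(M : ℤ)) M) B g := by
  obtain ⟨ι, s, a, ν, h1, h2, h3⟩ := h
  refine ⟨s.sup fun i => (ν i).natAbs, ι, s, a, ν, fun i hi => ?_, h2, h3⟩
  have : (ν i).natAbs ≤ s.sup fun i => (ν i).natAbs :=
    Finset.le_sup (f := fun i => (ν i).natAbs) hi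
  rw [mem_Icc]
  omega

/-- In the product of a trigonometric sum with a lacunary one, only a small part of the
coefficients can have low frequency. -/
lemma exists_split_mul [CompactSpace X] (h : IsTrigSum φ univ B g) (N k : ℕ) {c : ℕ → ℂ}
    (hc : ∀ i, ‖c i‖ ≤ 1) :
    ∃ U V R : C(X, ℂ), IsTrigSum φ (Ioi (N : ℤ)) (k * B) U ∧ IsTrigSum φ (Iio (-(N : ℤ))) (k * B) V ∧
      ‖R‖ ≤ B ∧
      (∑ i ∈ Finset.range k, c i • circlePow φ ((2 * N + 1) * i)) * g = U + V + R := by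
  obtain ⟨ι, s, a, ν, -, h2, h3⟩ := h
  set F : Finset (ℕ × ι) := Finset.range k ×ˢ s
  set b : ℕ × ι → ℂ := fun p => c p.1 * a p.2
  set μ : ℕ × ι → ℤ := fun p => (2 * N + 1) * p.1 + ν p.2
  have hb : ∀ p, ‖b p‖ ≤ ‖a p.2‖ := fun p => by
    rw [norm_mul]; exact mul_le_of_le_one_left (norm_nonneg _) (hc _)
  have hF : ∑ p ∈ F, ‖b p‖ ≤ k * B := by
    refine (Finset.sum_le_sum fun p _ => hb p).trans ?_
    rw [Finset.sum_product]
    simpa using mul_le_mul_of_nonneg_left h2 (Nat.cast_nonneg k)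
  have hsub : ∀ p : ℕ × ι → Prop, ∀ _ : DecidablePred p,
      ∑ q ∈ F.filter p, ‖b q‖ ≤ k * B := fun p _ =>
    (Finset.sum_le_sum_of_subset_of_nonneg (Finset.filter_subset _ _)
      fun _ _ _ => norm_nonneg _).trans hF
  set G : Finset (ℕ × ι) := F.filter fun p => ¬ (N : ℤ) < μ p
  refine ⟨∑ p ∈ F.filter (fun p => (N : ℤ) < μ p), b p • circlePow φ (μ p),
    ∑ p ∈ G.filter (fun p => μ p < -(N : ℤ)), b p • circlePow φ (μ p),
    ∑ p ∈ G.filter (fun p => ¬ μ p < -(N : ℤ)), b p • circlePow φ (μ p),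
    ⟨_, _, b, μ, ?_, hsub _ _, rfl⟩, ⟨_, _, b, μ, ?_, ?_, rfl⟩, ?_, ?_⟩
  · intro p hp; simpa using (Finset.mem_filter.1 hp).2
  · intro p hp; simpa using (Finset.mem_filter.1 hp).2
  · rw [Finset.filter_filter]; exact hsub _ _
  · refine (norm_sum_le _ _).trans (le_trans ?_ h2)
    have h4 : ∀ p ∈ G.filter (fun p => ¬ μ p < -(N : ℤ)),
        ‖b p • circlePow φ (μ p)‖ ≤ ‖a p.2‖ := fun p _ => by
      rw [norm_smul]
      exact (mul_le_of_le_one_right (norm_nonneg _) (norm_circlePow_le _)).trans (hb p)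
    refine (Finset.sum_le_sum h4).trans ?_
    have hinj : Set.InjOn Prod.snd (G.filter (fun p => ¬ μ p < -(N : ℤ)) : Set (ℕ × ι)) := by
      rintro ⟨i, x⟩ hp ⟨j, y⟩ hq (rfl : x = y)
      simp only [G, μ, Finset.coe_filter, Finset.mem_filter, mem_ofPred_eq] at hp hq
      have h5 : (2 * (N : ℤ) + 1) * (i - j) ≤ 2 * N := by linarith [hp.1.2, hq.2]
      have h6 : (2 * (N : ℤ) + 1) * (j - i) ≤ 2 * N := by linarith [hq.1.2, hp.2]
      have : (i : ℤ) = j := by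
        rcases lt_trichotomy (i : ℤ) j with h | h | h
        · nlinarith
        · exact h
        · nlinarith
      simpa using this
    classical
    rw [← Finset.sum_image (f := fun x => ‖a x‖) (g := Prod.snd) hinj]
    refine Finset.sum_le_sum_of_subset_of_nonneg ?_ fun _ _ _ => norm_nonneg _
    intro x hx
    obtain ⟨p, hp, rfl⟩ := Finset.mem_image.1 hx
    simp only [G, F, Finset.mem_filter, Finset.mem_product] at hp
    exact hp.1.1.2
  · rw [add_assoc, Finset.sum_filter_add_sum_filter_not, Finset.sum_filter_add_sum_filter_not, h3,
      Finset.sum_mul_sum, Finset.sum_product]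
    refine Finset.sum_congr rfl fun i _ => Finset.sum_congr rfl fun j _ => ?_
    rw [circlePow_add, smul_mul_smul_comm]

end IsTrigSum

/-- Rudin–Shapiro polynomials. -/
lemma exists_rudinShapiro (n : ℕ) : ∃ s t : ℕ → ℂ, (∀ i, ‖s i‖ ≤ 1) ∧ (∀ i, ‖t i‖ ≤ 1) ∧
    ∀ w : ℂ, ‖w‖ = 1 → ‖∑ i ∈ Finset.range (2 ^ n), s i * w ^ i‖ ^ 2 +
      ‖∑ i ∈ Finset.range (2 ^ n), t i * w ^ i‖ ^ 2 = 2 * 2 ^ n := by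
  induction n with
  | zero => exact ⟨1, 1, by simp, by simp, by intro w hw; norm_num⟩
  | succ n ih =>
    obtain ⟨s, t, hs, ht, h⟩ := ih
    refine ⟨fun i => if i < 2 ^ n then s i else t (i - 2 ^ n),
      fun i => if i < 2 ^ n then s i else -t (i - 2 ^ n), ?_, ?_, ?_⟩
    · intro i; dsimp only; split_ifs <;> simp [hs, ht]
    · intro i; dsimp only; split_ifs <;> simp [hs, ht]
    · intro w hw
      have key : ∀ ε : ℂ, ∑ i ∈ Finset.range (2 ^ (n + 1)),
          (if i < 2 ^ n then s i else ε * t (i - 2 ^ n)) * w ^ i =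
          ∑ i ∈ Finset.range (2 ^ n), s i * w ^ i +
            ε * (w ^ 2 ^ n * ∑ i ∈ Finset.range (2 ^ n), t i * w ^ i) := by
        intro ε
        rw [pow_succ, mul_two, Finset.sum_range_add]
        congr 1
        · exact Finset.sum_congr rfl fun i hi => by rw [if_pos (Finset.mem_range.1 hi)]
        · rw [Finset.mul_sum, Finset.mul_sum]
          refine Finset.sum_congr rfl fun i _ => ?_
          rw [if_neg (by omega), Nat.add_sub_cancel_left, pow_add]
          ring
      have k1 := key 1
      have k2 := key (-1)
      simp only [one_mul, neg_one_mul] at k1 k2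
      rw [k1, k2, ← sub_eq_add_neg]
      have := parallelogram_law_with_norm ℝ (∑ i ∈ Finset.range (2 ^ n), s i * w ^ i)
        (w ^ 2 ^ n * ∑ i ∈ Finset.range (2 ^ n), t i * w ^ i)
      rw [norm_mul, norm_pow, hw, one_pow, one_mul] at this
      have h' := h w hw
      have h2 : (2 : ℝ) ^ (n + 1) = 2 ^ n * 2 := pow_succ _ _
      linarith

variable [CompactSpace X]

/-- Under a Helson condition, `1` is within `1/2` of boundedly normed sums of high frequency. -/
lemma exists_trigSum_high_frequency {C : ℝ} (hC : 0 < C)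
    (H : ∀ g : C(X, ℂ), ∀ η > 0, ∃ g', IsTrigSum φ univ (C * ‖g‖) g' ∧ ‖g - g'‖ ≤ η) :
    ∃ A : ℝ, 1 ≤ A ∧ ∀ N : ℕ, ∃ U V, IsTrigSum φ (Ioi (N : ℤ)) A U ∧
      IsTrigSum φ (Iio (-(N : ℤ))) A V ∧ ‖1 - (U + V)‖ ≤ 1 / 2 := by
  obtain ⟨n, hn⟩ := pow_unbounded_of_one_lt (8 * (C + 1) ^ 2) one_lt_two
  obtain ⟨s, t, hs, ht, hst⟩ := exists_rudinShapiro n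
  set r : ℝ := √(2 * 2 ^ n) with hr
  have hr2 : r ^ 2 = 2 * 2 ^ n := Real.sq_sqrt (by positivity)
  have hr0 : 0 < r := by positivity
  have hrC : 4 * (C + 1) ≤ r := by
    rw [hr]; apply Real.le_sqrt_of_sq_le; nlinarith
  refine ⟨max 1 (C * r), le_max_left _ _, fun N => ?_⟩
  let P (c : ℕ → ℂ) : C(X, ℂ) :=
    ∑ i ∈ Finset.range (2 ^ n), c i • circlePow φ ((2 * N + 1) * i)
  have hP : ∀ c x, P c x =
      ∑ i ∈ Finset.range (2 ^ n), c i * (circlePow φ (2 * N + 1) x) ^ i := by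
    intro c x
    simp [P, circlePow, ContinuousMap.coe_sum, Finset.sum_apply, zpow_mul]
  have hsum : ∀ x, ‖P s x‖ ^ 2 + ‖P t x‖ ^ 2 = r ^ 2 := fun x => by
    rw [hP, hP, hr2]; exact hst _ (norm_circlePow_apply _ _)
  have hPs : ‖P s‖ ≤ r := (ContinuousMap.norm_le _ hr0.le).2 fun x =>
    abs_le_of_sq_le_sq' (by nlinarith [hsum x]) hr0.le |>.2
  have hPt : ‖P t‖ ≤ r := (ContinuousMap.norm_le _ hr0.le).2 fun x =>
    abs_le_of_sq_le_sq' (by nlinarith [hsum x]) hr0.le |>.2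
  have hone : P s * star (P s) + P t * star (P t) = ((r ^ 2 : ℝ) : ℂ) • (1 : C(X, ℂ)) := by
    ext x
    have := hsum x
    simp only [ContinuousMap.add_apply, ContinuousMap.mul_apply, ContinuousMap.star_apply,
      ContinuousMap.smul_apply, ContinuousMap.one_apply, RCLike.star_def, Complex.mul_conj',
      smul_eq_mul, mul_one]
    exact_mod_cast this
  have part : ∀ c : ℕ → ℂ, (∀ i, ‖c i‖ ≤ 1) → ‖P c‖ ≤ r → ∃ U V R : C(X, ℂ),
      IsTrigSum φ (Ioi (N : ℤ)) (2 ^ n * (C * r)) U ∧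
      IsTrigSum φ (Iio (-(N : ℤ))) (2 ^ n * (C * r)) V ∧
      ‖R‖ ≤ (C + 1) * r ∧ P c * star (P c) = U + V + R := by
    intro c hc hPc
    obtain ⟨L, hL, hL'⟩ := H (star (P c)) 1 one_pos
    rw [norm_star] at hL
    obtain ⟨U, V, R, hU, hV, hR, h⟩ :=
      (hL.mono subset_rfl (mul_le_mul_of_nonneg_left hPc hC.le)).exists_split_mul N (2 ^ n) hc
    refine ⟨U, V, R + P c * (star (P c) - L), by simpa using hU, by simpa using hV, ?_, ?_⟩
    · have h1 : ‖P c * (star (P c) - L)‖ ≤ r * 1 :=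
        (norm_mul_le _ _).trans (mul_le_mul hPc hL' (norm_nonneg _) hr0.le)
      linarith [norm_add_le R (P c * (star (P c) - L))]
    · rw [mul_sub, ← add_assoc, ← h]; ring
  obtain ⟨U₁, V₁, R₁, hU₁, hV₁, hR₁, h₁⟩ := part s hs hPs
  obtain ⟨U₂, V₂, R₂, hU₂, hV₂, hR₂, h₂⟩ := part t ht hPt
  have hnorm : ‖(((r ^ 2)⁻¹ : ℝ) : ℂ)‖ = (r ^ 2)⁻¹ := by
    rw [Complex.norm_real, Real.norm_of_nonneg (by positivity)]
  have hbd : ‖(((r ^ 2)⁻¹ : ℝ) : ℂ)‖ * (2 ^ n * (C * r) + 2 ^ n * (C * r)) ≤ max 1 (C * r) := by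
    refine le_trans (le_of_eq ?_) (le_max_right _ _)
    rw [hnorm, hr2]; field_simp; ring
  refine ⟨_, _, ((hU₁.add hU₂).smul (((r ^ 2)⁻¹ : ℝ) : ℂ)).mono subset_rfl hbd,
    ((hV₁.add hV₂).smul (((r ^ 2)⁻¹ : ℝ) : ℂ)).mono subset_rfl hbd, ?_⟩
  have h1 : (1 : C(X, ℂ)) - ((((r ^ 2)⁻¹ : ℝ) : ℂ) • (U₁ + U₂) + (((r ^ 2)⁻¹ : ℝ) : ℂ) • (V₁ + V₂))
      = (((r ^ 2)⁻¹ : ℝ) : ℂ) • (R₁ + R₂) := by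
    have h3 : (1 : C(X, ℂ)) = (((r ^ 2)⁻¹ : ℝ) : ℂ) • (((r ^ 2 : ℝ) : ℂ) • (1 : C(X, ℂ))) := by
      rw [smul_smul, ← Complex.ofReal_mul, inv_mul_cancel₀ (by positivity)]; simp
    rw [h3, ← hone, h₁, h₂, ← smul_add, ← smul_sub]
    congr 1; ring
  rw [h1, norm_smul, hnorm, inv_mul_le_iff₀ (by positivity)]
  nlinarith [norm_add_le R₁ R₂]

/-- Correlating blocks of very different frequencies yields a sum of positive frequency whose
real part is bounded below. -/
lemma exists_trigSum_correlation {A : ℝ}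
    (H : ∀ N : ℕ, ∃ U V, IsTrigSum φ (Ioi (N : ℤ)) A U ∧
      IsTrigSum φ (Iio (-(N : ℤ))) A V ∧ ‖1 - (U + V)‖ ≤ 1 / 2) (N n : ℕ) :
    ∃ u v W : C(X, ℂ), IsTrigSum φ univ (n * A) u ∧ IsTrigSum φ univ (n * A) v ∧
      IsTrigSum φ (Ioi (N : ℤ)) (n ^ 2 * A ^ 2) W ∧
      (∀ x, ‖n - (u x + v x)‖ ≤ n / 2) ∧
      ∀ x, ‖u x‖ ^ 2 + ‖v x‖ ^ 2 ≤ 2 * n * A ^ 2 + 2 * (W x).re := by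
  induction n with
  | zero =>
    refine ⟨0, 0, 0, ?_, ?_, ?_, by simp, by simp⟩ <;> simpa using IsTrigSum.zero
  | succ n ih =>
    obtain ⟨u, v, W, hu, hv, hW, h1, h2⟩ := ih
    obtain ⟨M₁, hM₁⟩ := hu.exists_Icc
    obtain ⟨M₂, hM₂⟩ := hv.exists_Icc
    obtain ⟨U, V, hU, hV, hUV⟩ := H (N + M₁ + M₂)
    have e1 : IsTrigSum φ (Ioi (N : ℤ)) (A * (n * A)) (U * star u) := by
      refine hU.mul (hM₁.star (S' := Icc (-(M₁ : ℤ)) M₁) ?_) ?_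
      · intro k; simp only [mem_Icc]; omega
      · intro k hk l; simp only [mem_Icc, mem_Ioi] at hk ⊢; push_cast at hk; omega
    have e2 : IsTrigSum φ (Ioi (N : ℤ)) (A * (n * A)) (star V * v) := by
      refine (hV.star (S' := Ioi ((N + M₁ + M₂ : ℕ) : ℤ)) ?_).mul hM₂ ?_
      · intro k; simp only [mem_Iio, mem_Ioi]; omega
      · intro k hk l; simp only [mem_Icc, mem_Ioi] at hk ⊢; push_cast at hk; omega
    have hadd : ((n + 1 : ℕ) : ℝ) * A = n * A + A := by push_cast; ring
    refine ⟨u + U, v + V, W + (U * star u + star V * v), ?_, ?_, ?_, ?_, ?_⟩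
    · rw [hadd]; exact hu.add (hU.mono (subset_univ _) le_rfl)
    · rw [hadd]; exact hv.add (hV.mono (subset_univ _) le_rfl)
    · refine (hW.add (e1.add e2)).mono subset_rfl ?_
      push_cast; nlinarith [sq_nonneg A]
    · intro x
      have h3 := (ContinuousMap.norm_coe_le_norm (1 - (U + V)) x).trans hUV
      have h4 : ((n + 1 : ℕ) : ℂ) - ((u + U) x + (v + V) x) =
          (n - (u x + v x)) + (1 - (U + V)) x := by
        simp; ring
      rw [h4]
      have h5 : ((n + 1 : ℕ) : ℝ) / 2 = n / 2 + 1 / 2 := by push_cast; ring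
      rw [h5]
      refine (norm_add_le _ _).trans ?_
      linarith [h1 x]
    · intro x
      have hUx := (ContinuousMap.norm_coe_le_norm U x).trans hU.norm_le
      have hVx := (ContinuousMap.norm_coe_le_norm V x).trans hV.norm_le
      have hsqU : ‖U x‖ ^ 2 ≤ A ^ 2 := by gcongr
      have hsqV : ‖V x‖ ^ 2 ≤ A ^ 2 := by gcongr
      have := h2 x
      simp only [← Complex.normSq_eq_norm_sq, Complex.normSq_apply] at this hsqU hsqV ⊢
      simp only [ContinuousMap.add_apply, ContinuousMap.mul_apply, ContinuousMap.star_apply,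
        RCLike.star_def, Complex.add_re, Complex.add_im, Complex.mul_re, Complex.conj_re,
        Complex.conj_im]
      push_cast
      nlinarith

lemma exists_trigSum_near_one {A : ℝ} (hA : 1 ≤ A)
    (H : ∀ N : ℕ, ∃ U V, IsTrigSum φ (Ioi (N : ℤ)) A U ∧
      IsTrigSum φ (Iio (-(N : ℤ))) A V ∧ ‖1 - (U + V)‖ ≤ 1 / 2) :
    ∃ q < 1, 0 ≤ q ∧ ∃ B, 0 < B ∧ ∀ N : ℕ, ∃ W, IsTrigSum φ (Ioi (N : ℤ)) B W ∧ ‖1 - W‖ ≤ q := by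
  obtain ⟨n, hn⟩ := exists_nat_gt (32 * A ^ 2)
  have hn0 : (0 : ℝ) < n := by nlinarith [sq_nonneg A]
  have hA4 : 1 ≤ A ^ 4 := one_le_pow₀ hA
  set τ : ℝ := 1 / (32 * A ^ 4) with hτ
  have hτ0 : 0 < τ := by positivity
  have hτA : τ * A ^ 4 = 1 / 32 := by rw [hτ]; field_simp
  have hτ1 : τ ≤ 1 := by nlinarith
  refine ⟨√(1 - τ / 32), ?_, Real.sqrt_nonneg _, τ * A ^ 2, by positivity, fun N => ?_⟩
  · rw [Real.sqrt_lt' one_pos]; linarith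
  obtain ⟨u, v, W, -, -, hW, h1, h2⟩ := exists_trigSum_correlation H N n
  have hc : ‖((τ / n ^ 2 : ℝ) : ℂ)‖ = τ / n ^ 2 := by
    rw [Complex.norm_real, Real.norm_of_nonneg (by positivity)]
  refine ⟨((τ / n ^ 2 : ℝ) : ℂ) • W, (hW.smul _).mono subset_rfl ?_, ?_⟩
  · rw [hc]; apply le_of_eq; field_simp
  refine (ContinuousMap.norm_le _ (Real.sqrt_nonneg _)).2 fun x => ?_
  apply Real.le_sqrt_of_sq_le
  have hWx : ‖W x‖ ≤ n ^ 2 * A ^ 2 := (ContinuousMap.norm_coe_le_norm W x).trans hW.norm_le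
  have huv : (n : ℝ) / 2 ≤ ‖u x‖ + ‖v x‖ := by
    have h3 : ‖(n : ℂ)‖ ≤ ‖(n : ℂ) - (u x + v x)‖ + ‖u x + v x‖ := by
      simpa using norm_add_le ((n : ℂ) - (u x + v x)) (u x + v x)
    rw [Complex.norm_natCast] at h3
    linarith [h1 x, norm_add_le (u x) (v x)]
  have hre : (n : ℝ) ^ 2 / 32 ≤ (W x).re := by
    nlinarith [h2 x, sq_nonneg (‖u x‖ - ‖v x‖)]
  have hsq : ((W x).re * (W x).re + (W x).im * (W x).im) ≤ n ^ 4 * A ^ 4 := by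
    rw [← Complex.normSq_apply, Complex.normSq_eq_norm_sq]
    calc ‖W x‖ ^ 2 ≤ (n ^ 2 * A ^ 2) ^ 2 := by gcongr
      _ = _ := by ring
  set c : ℝ := τ / n ^ 2
  have hcn : c * n ^ 2 = τ := by simp only [c]; field_simp
  have hc0 : 0 < c := by positivity
  rw [← Complex.normSq_eq_norm_sq, Complex.normSq_apply]
  simp only [ContinuousMap.sub_apply, ContinuousMap.one_apply, ContinuousMap.smul_apply,
    smul_eq_mul, Complex.sub_re, Complex.sub_im, Complex.one_re, Complex.one_im,
    Complex.re_ofReal_mul, Complex.im_ofReal_mul]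
  have h5 : c * (n ^ 2 / 32) ≤ c * (W x).re := by gcongr
  have h6 : c ^ 2 * ((W x).re * (W x).re + (W x).im * (W x).im) ≤ c ^ 2 * (n ^ 4 * A ^ 4) := by
    gcongr
  have h7 : c ^ 2 * (n ^ 4 * A ^ 4) = τ * (1 / 32) := by
    rw [← hτA, ← hcn]; ring
  nlinarith

/-- Under a Helson condition, every continuous function is approximated, with a fixed relative
error, by boundedly normed sums of arbitrarily high positive frequency. -/
lemma exists_trigSum_positive_frequency {C : ℝ} (hC : 0 < C)
    (H : ∀ g : C(X, ℂ), ∀ η > 0, ∃ g', IsTrigSum φ univ (C * ‖g‖) g' ∧ ‖g - g'‖ ≤ η) :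
    ∃ θ < 1, 0 ≤ θ ∧ ∃ B, 0 ≤ B ∧ ∀ (N : ℕ) (g : C(X, ℂ)),
      ∃ h, IsTrigSum φ (Ioi (N : ℤ)) (B * ‖g‖) h ∧ ‖g - h‖ ≤ θ * ‖g‖ := by
  obtain ⟨A, hA, hA'⟩ := exists_trigSum_high_frequency hC H
  obtain ⟨q, hq, hq0, B, hB, hW⟩ := exists_trigSum_near_one hA hA'
  refine ⟨(1 + q) / 2, by linarith, by linarith, B * C, by positivity, fun N g => ?_⟩
  rcases eq_or_ne g 0 with rfl | hg
  · exact ⟨0, by simpa using IsTrigSum.zero, by simp⟩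
  have hg0 : 0 < ‖g‖ := norm_pos_iff.2 hg
  obtain ⟨g', hg', hgg'⟩ := H g ((1 - q) / (2 * B) * ‖g‖)
    (mul_pos (div_pos (by linarith) (by positivity)) hg0)
  obtain ⟨M, hM⟩ := hg'.exists_Icc
  obtain ⟨W, hWt, hW1⟩ := hW (N + M)
  refine ⟨W * g', (hWt.mul hM ?_).mono subset_rfl (mul_assoc _ _ _).ge, ?_⟩
  · intro k hk l; simp only [mem_Icc, mem_Ioi] at hk ⊢; push_cast at hk; omega
  have h1 : g - W * g' = (1 - W) * g + W * (g - g') := by ring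
  have h2 : ‖(1 - W) * g‖ ≤ q * ‖g‖ :=
    (norm_mul_le _ _).trans (mul_le_mul_of_nonneg_right hW1 (norm_nonneg _))
  have h3 : ‖W * (g - g')‖ ≤ B * ((1 - q) / (2 * B) * ‖g‖) :=
    (norm_mul_le _ _).trans (mul_le_mul hWt.norm_le hgg' (norm_nonneg _) hB.le)
  have h4 : B * ((1 - q) / (2 * B) * ‖g‖) = (1 - q) / 2 * ‖g‖ := by field_simp
  rw [h1]
  linarith [norm_add_le ((1 - W) * g) (W * (g - g'))]

end TrigSums

section AbsolutelyConvergent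

/-- Successive approximation: a bounded operator whose range approximates every vector with a
fixed relative error `θ < 1`, with norm control, is surjective with norm control. -/
lemma exists_preimage_of_approx {E F : Type*} [NormedAddCommGroup E] [NormedSpace ℂ E]
    [CompleteSpace E] [NormedAddCommGroup F] [NormedSpace ℂ F] (T : E →L[ℂ] F) {θ B : ℝ}
    (hθ0 : 0 ≤ θ) (hθ : θ < 1) (hB : 0 ≤ B)
    (H : ∀ y, ∃ x, ‖x‖ ≤ B * ‖y‖ ∧ ‖y - T x‖ ≤ θ * ‖y‖) (y : F) :
    ∃ x, T x = y ∧ ‖x‖ ≤ B * (1 - θ)⁻¹ * ‖y‖ := by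
  choose e he1 he2 using H
  let r : ℕ → F := fun k => (fun z => z - T (e z))^[k] y
  have hr : ∀ k, r (k + 1) = r k - T (e (r k)) := fun k => Function.iterate_succ_apply' _ _ _
  have hrn : ∀ k, ‖r k‖ ≤ θ ^ k * ‖y‖ := by
    intro k
    induction k with
    | zero => simp [r]
    | succ k ih =>
      rw [hr, pow_succ', mul_assoc]
      exact (he2 _).trans (mul_le_mul_of_nonneg_left ih hθ0)
  have hen : ∀ k, ‖e (r k)‖ ≤ B * ‖y‖ * θ ^ k := fun k =>
    (he1 _).trans ((mul_le_mul_of_nonneg_left (hrn k) hB).trans (le_of_eq (by ring)))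
  have hgeo := (hasSum_geometric_of_lt_one hθ0 hθ).mul_left (B * ‖y‖)
  have hsum : Summable fun k => e (r k) := .of_norm_bounded hgeo.summable hen
  refine ⟨∑' k, e (r k), ?_, ?_⟩
  · have h1 := (T.hasSum hsum.hasSum).tendsto_sum_nat
    have h2 : ∀ n, ∑ k ∈ Finset.range n, T (e (r k)) = y - r n := by
      intro n
      induction n with
      | zero => simp [r]
      | succ n ih => rw [Finset.sum_range_succ, ih, hr]; abel
    have h3 : Tendsto r atTop (nhds 0) := by
      refine squeeze_zero_norm hrn ?_
      simpa using (tendsto_pow_atTop_nhds_zero_of_lt_one hθ0 hθ).mul_const ‖y‖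
    simp only [h2] at h1
    exact tendsto_nhds_unique h1 (by simpa using h3.const_sub y)
  · refine (tsum_of_norm_bounded hgeo hen).trans (le_of_eq (by ring))

variable {ι : Type*}

lemma hasSum_norm_lp_one (a : lp (fun _ : ι => ℂ) 1) : HasSum (fun i => ‖a i‖) ‖a‖ := by
  simpa using lp.hasSum_norm (by simp) a

variable {X : Type*} [TopologicalSpace X] [CompactSpace X] (φ : C(X, Circle)) (ν : ι → ℤ)

lemma summable_smul_circlePow (a : lp (fun _ : ι => ℂ) 1) :
    Summable fun i => a i • circlePow φ (ν i) := by
  refine .of_norm_bounded (hasSum_norm_lp_one a).summable fun i => ?_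
  rw [norm_smul]
  exact mul_le_of_le_one_right (norm_nonneg _) (norm_circlePow_le _)

/-- Summation of an absolutely convergent series with frequencies `ν`. -/
def circleSeries : lp (fun _ : ι => ℂ) 1 →L[ℂ] C(X, ℂ) :=
  LinearMap.mkContinuous
    { toFun := fun a => ∑' i, a i • circlePow φ (ν i)
      map_add' := fun a b => by
        simp only [lp.coeFn_add, Pi.add_apply, add_smul]
        exact (summable_smul_circlePow φ ν a).tsum_add (summable_smul_circlePow φ ν b)
      map_smul' := fun c a => by
        simp only [lp.coeFn_smul, Pi.smul_apply, smul_assoc, RingHom.id_apply]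
        exact (summable_smul_circlePow φ ν a).tsum_const_smul c }
    1 fun a => by
      rw [one_mul]
      refine tsum_of_norm_bounded (hasSum_norm_lp_one a) fun i => ?_
      rw [norm_smul]
      exact mul_le_of_le_one_right (norm_nonneg _) (norm_circlePow_le _)

lemma hasSum_circleSeries (a : lp (fun _ : ι => ℂ) 1) :
    HasSum (fun i => a i • circlePow φ (ν i)) (circleSeries φ ν a) :=
  (summable_smul_circlePow φ ν a).hasSum

lemma hasSum_circleSeries_apply (a : lp (fun _ : ι => ℂ) 1) (x : X) :
    HasSum (fun i => a i * circlePow φ (ν i) x) (circleSeries φ ν a x) :=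
  (hasSum_circleSeries φ ν a).map (ContinuousMap.evalCLM ℂ x) (ContinuousMap.evalCLM ℂ x).continuous

lemma circleSeries_single [DecidableEq ι] (i : ι) (c : ℂ) :
    circleSeries φ ν (lp.single 1 i c) = c • circlePow φ (ν i) := by
  have h := hasSum_circleSeries φ ν (lp.single 1 i c)
  refine h.unique ?_
  have := hasSum_single (f := fun j => (lp.single 1 i c : lp (fun _ : ι => ℂ) 1) j •
    circlePow φ (ν j)) i fun j hj => by rw [lp.single_apply_ne _ _ _ hj, zero_smul]
  simpa using this

lemma IsTrigSum.exists_circleSeries {S : Set ℤ} {B : ℝ} {g : C(X, ℂ)} (h : IsTrigSum φ S B g)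
    {j : ℤ → ι}
    (hj : ∀ n ∈ S, ν (j n) = n) : ∃ e, ‖e‖ ≤ B ∧ circleSeries φ ν e = g := by
  classical
  obtain ⟨κ, s, a, μ, h1, h2, h3⟩ := h
  refine ⟨∑ i ∈ s, lp.single 1 (j (μ i)) (a i), ?_, ?_⟩
  · refine (norm_sum_le _ _).trans (le_trans (Finset.sum_le_sum fun i _ => ?_) h2)
    rw [lp.norm_single (by simp)]
  · rw [map_sum, h3]
    exact Finset.sum_congr rfl fun i hi => by rw [circleSeries_single, hj _ (h1 i hi)]

/-- If every continuous function is an absolutely convergent series in `φ`, then it is such a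
series with frequencies at least `N` only, with norm control independent of `N`. -/
lemma exists_circleSeries_high_frequency (hφ : Function.Surjective (circleSeries φ (id : ℤ → ℤ))) :
    ∃ D, 0 ≤ D ∧ ∀ (N : ℕ) (g : C(X, ℂ)),
      ∃ e, circleSeries φ (fun n : ℕ => (n + N : ℤ)) e = g ∧ ‖e‖ ≤ D * ‖g‖ := by
  obtain ⟨C, hC, hlift⟩ := (circleSeries φ (id : ℤ → ℤ)).exists_preimage_norm_le hφ
  have H : ∀ g : C(X, ℂ), ∀ η > 0, ∃ g', IsTrigSum φ univ (C * ‖g‖) g' ∧ ‖g - g'‖ ≤ η := by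
    intro g η hη
    obtain ⟨a, rfl, ha⟩ := hlift g
    obtain ⟨s, hs⟩ := ((Metric.tendsto_nhds.1 (hasSum_circleSeries φ id a)) η hη).exists
    refine ⟨_, ⟨ℤ, s, a, id, by simp, ?_, rfl⟩, ?_⟩
    · exact (sum_le_hasSum s (fun _ _ => norm_nonneg _) (hasSum_norm_lp_one a)).trans ha
    · rw [← dist_eq_norm, dist_comm]; exact hs.le
  obtain ⟨θ, hθ, hθ0, B, hB, hpos⟩ := exists_trigSum_positive_frequency hC H
  refine ⟨B * (1 - θ)⁻¹, mul_nonneg hB (inv_nonneg.2 (by linarith)), fun N g =>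
    exists_preimage_of_approx _ hθ0 hθ hB (fun y => ?_) g⟩
  obtain ⟨h, hh, hyh⟩ := hpos N y
  obtain ⟨e, he, rfl⟩ := hh.exists_circleSeries φ (fun n : ℕ => (n + N : ℤ)) (j := fun n => (n - N).toNat)
    fun n hn => by simp only [mem_Ioi] at hn; omega
  exact ⟨e, he, hyh⟩

end AbsolutelyConvergent

lemma taylorCoeff_eq {f : ℂ → ℂ} {a : ℕ → ℂ} (ha : Summable fun n => ‖a n‖)
    (hf : ∀ z ∈ Metric.closedBall (0 : ℂ) 1, HasSum (fun n => a n * z ^ n) (f z)) (n : ℕ) :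
    taylorCoeff f n = a n := by
  have hp : HasFPowerSeriesOnBall f (FormalMultilinearSeries.ofScalars ℂ a) 0 1 := by
    refine ⟨?_, one_pos, ?_⟩
    · rw [← ENNReal.coe_one]
      refine FormalMultilinearSeries.le_radius_of_summable _ ?_
      simpa [FormalMultilinearSeries.ofScalars_norm] using ha
    · intro y hy
      have hy' : y ∈ Metric.closedBall (0 : ℂ) 1 := by
        rw [← ENNReal.ofReal_one, Metric.eball_ofReal] at hy
        exact Metric.ball_subset_closedBall hy
      simpa [FormalMultilinearSeries.ofScalars_apply_eq, mul_comm] using hf y hy'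
  have h := hp.factorial_smul 1 n
  rw [FormalMultilinearSeries.ofScalars_apply_eq, ← iteratedDeriv_eq_iteratedFDeriv] at h
  rw [taylorCoeff, ← h]
  have : (n.factorial : ℂ) ≠ 0 := Nat.cast_ne_zero.2 n.factorial_ne_zero
  simp; field_simp

/-- The inclusion of a subset of the unit circle, as a circle-valued function. -/
def sphereInclusion {K : Set ℂ} (hK : K ⊆ Metric.sphere (0 : ℂ) 1) : C(K, Circle) :=
  ⟨fun z => ⟨z, hK z.2⟩, by
    exact continuous_induced_rng.2 continuous_subtype_val⟩

lemma circlePow_sphereInclusion_apply {K : Set ℂ} (hK : K ⊆ Metric.sphere (0 : ℂ) 1) (n : ℤ)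
    (z : K) : circlePow (sphereInclusion hK) n z = (z : ℂ) ^ n :=
  Circle.coe_zpow _ n

lemma IsHelson.surjective_circleSeries {K : Set ℂ} (hK : IsHelson K) [CompactSpace K] :
    Function.Surjective (circleSeries (sphereInclusion hK.2.1) (id : ℤ → ℤ)) := by
  classical
  intro g
  obtain ⟨w, ⟨hw1, hw2⟩, hgw⟩ := hK.2.2 (fun z => if h : z ∈ K then g ⟨z, h⟩ else 0) (by
    rw [continuousOn_iff_continuous_domRestrict]
    convert g.continuous using 1
    ext z
    simp)
  refine ⟨⟨fcoeff w, memℓp_gen (by simpa using hw1)⟩, ?_⟩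
  ext z
  refine (hasSum_circleSeries_apply _ _ _ z).unique ?_
  have h := hw2 z (hK.2.1 z.2)
  rw [← hgw z z.2, dif_pos z.2] at h
  simpa only [circlePow_sphereInclusion_apply, id] using h

/-- If `K` is a Helson set, then `I⁺(K)` is weak-star dense in `A⁺`. -/
theorem stmt_10 (K : Set ℂ) (hK : IsHelson K) :
    WStarDense (IPlus K) := by
  have : CompactSpace K := isCompact_iff_compactSpace.1 hK.1
  intro f hf m c hc ε hε
  obtain ⟨a, ha, hfa⟩ := hf
  set φ := sphereInclusion hK.2.1
  obtain ⟨D, hD, hseries⟩ := exists_circleSeries_high_frequency φ hK.surjective_circleSeries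
  let a' : lp (fun _ : ℕ => ℂ) 1 := ⟨a, memℓp_gen (by simpa using ha)⟩
  set g₀ : C(K, ℂ) := circleSeries φ (fun n : ℕ => (n : ℤ)) a'
  have hg₀ : ∀ z : K, g₀ z = f z := by
    intro z
    refine (hasSum_circleSeries_apply _ _ _ z).unique ?_
    simpa only [φ, circlePow_sphereInclusion_apply, zpow_natCast] using
      hfa z (Metric.sphere_subset_closedBall (hK.2.1 z.2))
  set δ : ℝ := ε / (D * ‖g₀‖ + 1)
  have hDg : 0 < D * ‖g₀‖ + 1 := by positivity
  have hδ : 0 < δ := by positivity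
  obtain ⟨N, hN⟩ : ∃ N : ℕ, ∀ n, N ≤ n → ∀ i, ‖c i n‖ < δ := by
    have : ∀ᶠ n in atTop, ∀ i, ‖c i n‖ < δ := eventually_all.2 fun i => by
      simpa using Metric.tendsto_nhds.1 (hc i) δ hδ
    exact eventually_atTop.1 this
  obtain ⟨e, he, heD⟩ := hseries N g₀
  have hen := hasSum_norm_lp_one e
  -- the coefficients of `z ^ N * ∑ e n z ^ n`
  set b : ℕ → ℂ := Function.extend (fun n => n + N) e 0
  have hinj : Function.Injective fun n : ℕ => n + N := add_left_injective N
  have hb : ∀ F : ℕ → ℂ, ∀ s, HasSum (fun n => e n * F (n + N)) s →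
      HasSum (fun n => b n * F n) s := by
    intro F s h
    refine (hinj.hasSum_iff (f := fun n => b n * F n) ?_).1 ?_
    · intro n hn
      simp only [b]
      rw [Function.extend_apply' _ _ _ (by simpa using hn)]
      simp
    · convert! h using 2 with n
      simp [b, hinj.extend_apply]
  have hbn : Summable fun n => ‖b n‖ := by
    refine (hinj.summable_iff (f := fun n => ‖b n‖) ?_).1 ?_
    · intro n hn
      simp only [b]
      rw [Function.extend_apply' _ _ _ (by simpa using hn)]
      simp
    · convert! hen.summable using 2 with n
      simp [b, hinj.extend_apply]
  have hab : Summable fun n => ‖a n - b n‖ :=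
    .of_nonneg_of_le (fun _ => norm_nonneg _) (fun _ => norm_sub_le _ _) (ha.add hbn)
  have hG : ∀ z ∈ Metric.closedBall (0 : ℂ) 1,
      HasSum (fun n => (a n - b n) * z ^ n) (∑' n, (a n - b n) * z ^ n) := by
    intro z hz
    refine (Summable.of_norm_bounded hab fun n => ?_).hasSum
    rw [norm_mul, norm_pow]
    exact mul_le_of_le_one_right (norm_nonneg _)
      (pow_le_one₀ (norm_nonneg _) (mem_closedBall_zero_iff.1 hz))
  refine ⟨fun z => ∑' n, (a n - b n) * z ^ n, ⟨⟨_, hab, hG⟩, fun z hz => ?_⟩, fun i => ?_⟩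
  · have h1 := hasSum_circleSeries_apply φ (fun n : ℕ => (n + N : ℤ)) e ⟨z, hz⟩
    rw [he, hg₀] at h1
    have h2 := hb (fun n => z ^ n) (f z) (by
      simpa only [φ, circlePow_sphereInclusion_apply, ← Nat.cast_add, zpow_natCast] using h1)
    have h3 := (hfa z (Metric.sphere_subset_closedBall (hK.2.1 hz))).sub h2
    simpa [sub_mul] using h3.tsum_eq
  · have hcb : ∃ M, ∀ n, ‖c i n‖ ≤ M := by
      obtain ⟨M, hM⟩ := (Metric.isBounded_range_of_tendsto _ (hc i)).exists_norm_le
      exact ⟨M, fun n => hM _ (mem_range_self n)⟩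
    obtain ⟨M, hM⟩ := hcb
    have hs : ∀ {d : ℕ → ℂ}, (Summable fun n => ‖d n‖) → Summable fun n => d n * c i n := by
      intro d hd
      refine .of_norm_bounded (hd.mul_right M) fun n => ?_
      rw [norm_mul]
      exact mul_le_mul_of_nonneg_left (hM n) (norm_nonneg _)
    have hle : ∀ n, ‖e n * c i (n + N)‖ ≤ ‖e n‖ * δ := fun n => by
      rw [norm_mul]
      exact mul_le_mul_of_nonneg_left (hN _ (Nat.le_add_left _ _) i).le (norm_nonneg _)
    have hes : Summable fun n => e n * c i (n + N) :=
      .of_norm_bounded (hen.mul_right δ).summable hle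
    have hdiff : pairing f (c i) - pairing (fun z => ∑' n, (a n - b n) * z ^ n) (c i) =
        ∑' n, e n * c i (n + N) := by
      simp only [pairing, taylorCoeff_eq ha hfa, taylorCoeff_eq hab hG]
      rw [← (hs ha).tsum_sub (hs hab), ← (hb (c i) _ hes.hasSum).tsum_eq]
      exact tsum_congr fun n => by ring
    rw [hdiff]
    calc ‖∑' n, e n * c i (n + N)‖ ≤ ‖e‖ * δ := tsum_of_norm_bounded (hen.mul_right δ) hle
      _ ≤ D * ‖g₀‖ * δ := mul_le_mul_of_nonneg_right heD hδ.le
      _ < (D * ‖g₀‖ + 1) * δ := mul_lt_mul_of_pos_right (lt_add_one _) hδ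
      _ = ε := mul_div_cancel₀ _ hDg.ne'
end
end
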